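/- Let n ≥ 2 and 0 < μ < n. Suppose u ∈ Cⁿ(ℝⁿ) satisfies condition (B) and the integral equation (IE). Then λ_b > 0 for every b ∈ ℝⁿ. -/

import Mathlib

open MeasureTheory Real Filter Metric

noncomputable section

/-- The nonlocal term `v(x) = ∫ e^{((2n-μ)/2) u(y)} / |x-y|^μ dy`. -/
noncomputable def V (n : ℕ) (μ : ℝ) (u : EuclideanSpace ℝ (Fin n) → ℝ)
    (x : EuclideanSpace ℝ (Fin n)) : ℝ :=
  ∫ y : EuclideanSpace ℝ (Fin n),
    Real.exp ((2 * n - μ) / 2 * u y) / ‖x - y‖ ^ μ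

/-- `βₙ = 2^{n-1} Γ(n/2+1) Γ(n/2) ωₙ` with `ωₙ` the volume of the unit ball in `ℝⁿ`. -/
noncomputable def betaN (n : ℕ) : ℝ :=
  2 ^ (n - 1) * Real.Gamma ((n : ℝ) / 2 + 1) * Real.Gamma ((n : ℝ) / 2) *
    (volume (Metric.ball (0 : EuclideanSpace ℝ (Fin n)) 1)).toReal

/-- Condition (B): finite weighted volume and finite total curvature. -/
def CondB (n : ℕ) (μ : ℝ) (u : EuclideanSpace ℝ (Fin n) → ℝ) : Prop :=
  Integrable (fun y : EuclideanSpace ℝ (Fin n) => Real.exp ((2 * n - μ) / 2 * u y)) ∧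
  Integrable (fun p : EuclideanSpace ℝ (Fin n) × EuclideanSpace ℝ (Fin n) =>
    Real.exp ((2 * n - μ) / 2 * u p.1) * Real.exp ((2 * n - μ) / 2 * u p.2) / ‖p.1 - p.2‖ ^ μ)

/-- The integral equation (IE). -/
def IE (n : ℕ) (μ : ℝ) (u : EuclideanSpace ℝ (Fin n) → ℝ) : Prop :=
  ∃ C : ℝ, ∀ x : EuclideanSpace ℝ (Fin n), u x = (1 / betaN n) *
    (∫ y, Real.log ((‖y‖ + 1) / ‖x - y‖) * (V n μ u y * Real.exp ((2 * n - μ) / 2 * u y))) + C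

/-- `α = (1/βₙ) ∫ v(y) e^{((2n-μ)/2) u(y)} dy`. -/
noncomputable def alphaC (n : ℕ) (μ : ℝ) (u : EuclideanSpace ℝ (Fin n) → ℝ) : ℝ :=
  (1 / betaN n) * ∫ y, V n μ u y * Real.exp ((2 * n - μ) / 2 * u y)

/-- `w_{λ,b}(x) = u(b + x/|x|²) − 2 ln|x| − u(b + x/λ²) + 2 ln λ`. -/
noncomputable def wMS (n : ℕ) (u : EuclideanSpace ℝ (Fin n) → ℝ)
    (b : EuclideanSpace ℝ (Fin n)) (l : ℝ) (x : EuclideanSpace ℝ (Fin n)) : ℝ :=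
  u (b + (‖x‖ ^ 2)⁻¹ • x) - 2 * Real.log ‖x‖ - u (b + (l ^ 2)⁻¹ • x) + 2 * Real.log l

/-- `z_{λ,b}(x) = |x|^{−μ} v(b + x/|x|²) − λ^{−μ} v(b + x/λ²)`. -/
noncomputable def zMS (n : ℕ) (μ : ℝ) (u : EuclideanSpace ℝ (Fin n) → ℝ)
    (b : EuclideanSpace ℝ (Fin n)) (l : ℝ) (x : EuclideanSpace ℝ (Fin n)) : ℝ :=
  ‖x‖ ^ (-μ) * V n μ u (b + (‖x‖ ^ 2)⁻¹ • x) - l ^ (-μ) * V n μ u (b + (l ^ 2)⁻¹ • x)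

/-- The critical moving-spheres radius `λ_b`. -/
noncomputable def lambdaB (n : ℕ) (μ : ℝ) (u : EuclideanSpace ℝ (Fin n) → ℝ)
    (b : EuclideanSpace ℝ (Fin n)) : ℝ :=
  sInf {l : ℝ | 0 < l ∧ ∀ ρ : ℝ, l ≤ ρ → ∀ x : EuclideanSpace ℝ (Fin n),
    0 < ‖x‖ → ‖x‖ < ρ → 0 ≤ wMS n u b ρ x ∧ 0 ≤ zMS n μ u b ρ x}

open scoped Topology

theorem integrableOn_ball_norm_sub_rpow {n : ℕ} (hn : 1 ≤ n) {κ : ℝ} (hκ : κ < n)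
    (x : EuclideanSpace ℝ (Fin n)) (r : ℝ) :
    IntegrableOn (fun y => ‖x - y‖ ^ (-κ)) (ball x r) := by
  have h0 : IntegrableOn (fun z : EuclideanSpace ℝ (Fin n) => ‖z‖ ^ (-κ)) (ball 0 r) := by
    refine integrableOn_ball_of_norm_le_rpow (C := 1) (α := κ) (by simpa using hn)
      (by simpa using hκ) ?_ ?_
    · refine ae_of_all _ fun z => ?_
      rw [Real.norm_of_nonneg (by positivity), one_mul]
    · exact (measurable_norm.pow_const _).aestronglyMeasurable
  rw [← integrable_indicator_iff measurableSet_ball] at h0 ⊢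
  refine (h0.comp_sub_left x).congr (ae_of_all _ fun y => ?_)
  simp only [Set.indicator, mem_ball, dist_eq_norm, norm_sub_rev x y, sub_zero]

theorem setIntegral_ball_norm_sub_rpow {n : ℕ} {κ : ℝ}
    (x : EuclideanSpace ℝ (Fin n)) {r : ℝ} (hr : 0 < r) :
    ∫ y in ball x r, ‖x - y‖ ^ (-κ) =
      (∫ z in ball (0 : EuclideanSpace ℝ (Fin n)) 1, ‖z‖ ^ (-κ)) * r ^ (n - κ) := by
  have h1 : ∫ y in ball x r, ‖x - y‖ ^ (-κ) =
      ∫ z in ball (0 : EuclideanSpace ℝ (Fin n)) r, ‖z‖ ^ (-κ) := by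
    rw [← integral_indicator measurableSet_ball, ← integral_indicator measurableSet_ball,
      ← integral_sub_left_eq_self _ volume x]
    refine integral_congr_ae (ae_of_all _ fun y => ?_)
    simp only [Set.indicator, mem_ball, dist_eq_norm, sub_sub_cancel, sub_sub_cancel_left,
      norm_neg, sub_zero]
  have h2 := Measure.setIntegral_comp_smul_of_pos
    (volume : Measure (EuclideanSpace ℝ (Fin n))) (fun z => ‖z‖ ^ (-κ)) (ball 0 1) hr
  rw [_root_.smul_ball hr.ne', smul_zero, Real.norm_of_nonneg hr.le, mul_one] at h2
  simp only [norm_smul, Real.norm_of_nonneg hr.le, finrank_euclideanSpace, Fintype.card_fin,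
    smul_eq_mul, Real.mul_rpow hr.le (norm_nonneg _), integral_const_mul] at h2
  rw [h1, Real.rpow_sub hr, Real.rpow_natCast]
  rw [Real.rpow_neg hr.le] at h2
  field_simp at h2 ⊢
  linarith

/-- An integrable function that is bounded near `x` has a finite Riesz potential at `x`. -/
theorem integrable_mul_norm_sub_rpow {n : ℕ} (hn : 1 ≤ n) {κ : ℝ} (hκ0 : 0 ≤ κ) (hκ : κ < n)
    {g : EuclideanSpace ℝ (Fin n) → ℝ} (hg : Integrable g) (hg0 : ∀ y, 0 ≤ g y)
    {x : EuclideanSpace ℝ (Fin n)} {r M : ℝ} (hr : 0 < r) (hM : ∀ y ∈ ball x r, g y ≤ M) :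
    Integrable (fun y => g y * ‖x - y‖ ^ (-κ)) ∧
    ∫ y, g y * ‖x - y‖ ^ (-κ) ≤
      M * ((∫ z in ball (0 : EuclideanSpace ℝ (Fin n)) 1, ‖z‖ ^ (-κ)) * r ^ (n - κ)) +
        r ^ (-κ) * ∫ y, g y := by
  set I := fun y => (ball x r).indicator (fun y => ‖x - y‖ ^ (-κ)) y with hI
  have hIint : Integrable I :=
    (integrable_indicator_iff measurableSet_ball).2 (integrableOn_ball_norm_sub_rpow hn hκ x r)
  have hdom : Integrable (fun y => M * I y + r ^ (-κ) * g y) :=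
    (hIint.const_mul M).add (hg.const_mul _)
  have hle : ∀ y, g y * ‖x - y‖ ^ (-κ) ≤ M * I y + r ^ (-κ) * g y := by
    intro y
    by_cases hy : y ∈ ball x r
    · simp only [hI, Set.indicator_of_mem hy]
      have := mul_le_mul_of_nonneg_right (hM y hy) (Real.rpow_nonneg (norm_nonneg (x - y)) (-κ))
      have := mul_nonneg (Real.rpow_nonneg hr.le (-κ)) (hg0 y)
      linarith
    · simp only [hI, Set.indicator_of_notMem hy, mul_zero, zero_add]
      rw [mul_comm]
      refine mul_le_mul_of_nonneg_right ?_ (hg0 y)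
      rw [mem_ball, not_lt, dist_eq_norm, norm_sub_rev] at hy
      exact Real.rpow_le_rpow_of_nonpos hr hy (by linarith)
  have hint : Integrable (fun y => g y * ‖x - y‖ ^ (-κ)) := by
    refine hdom.mono' (hg.1.mul ?_) (ae_of_all _ fun y => ?_)
    · exact ((measurable_const.sub measurable_id).norm.pow_const _).aestronglyMeasurable
    · rw [Real.norm_of_nonneg (mul_nonneg (hg0 y) (by positivity))]
      exact hle y
  refine ⟨hint, (integral_mono hint hdom hle).trans_eq ?_⟩
  rw [integral_add (hIint.const_mul M) (hg.const_mul _), integral_const_mul, integral_const_mul,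
    hI, integral_indicator measurableSet_ball, setIntegral_ball_norm_sub_rpow x hr]

/-- The Riesz potential `x ↦ ∫ F(y) / |x-y|^μ dy`. -/
def rieszPot {n : ℕ} (μ : ℝ) (F : EuclideanSpace ℝ (Fin n) → ℝ)
    (x : EuclideanSpace ℝ (Fin n)) : ℝ :=
  ∫ y, F y / ‖x - y‖ ^ μ

theorem rieszPot_eq {n : ℕ} (μ : ℝ) (F : EuclideanSpace ℝ (Fin n) → ℝ)
    (x : EuclideanSpace ℝ (Fin n)) : rieszPot μ F x = ∫ y, F y * ‖x - y‖ ^ (-μ) := by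
  simp only [rieszPot, Real.rpow_neg (norm_nonneg _), div_eq_mul_inv]

theorem exists_bound_on_balls {n : ℕ} {F : EuclideanSpace ℝ (Fin n) → ℝ} (hF : Continuous F)
    (R : ℝ) : ∃ M, 0 ≤ M ∧ ∀ y : EuclideanSpace ℝ (Fin n), ‖y‖ ≤ R → F y ≤ M := by
  obtain ⟨M, hM⟩ := (isCompact_closedBall (0 : EuclideanSpace ℝ (Fin n)) R).exists_bound_of_continuousOn
    hF.continuousOn
  refine ⟨max M 0, le_max_right _ _, fun y hy => ?_⟩
  exact (le_abs_self _).trans ((hM y (by simpa using hy)).trans (le_max_left _ _))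

theorem integrable_rieszPot {n : ℕ} (hn : 1 ≤ n) {μ : ℝ} (hμ0 : 0 < μ) (hμn : μ < n)
    {F : EuclideanSpace ℝ (Fin n) → ℝ} (hF : Continuous F) (hF0 : ∀ y, 0 ≤ F y)
    (hFi : Integrable F) (x : EuclideanSpace ℝ (Fin n)) :
    Integrable (fun y => F y * ‖x - y‖ ^ (-μ)) := by
  obtain ⟨M, -, hM⟩ := exists_bound_on_balls hF (‖x‖ + 1)
  refine (integrable_mul_norm_sub_rpow hn hμ0.le hμn hFi hF0 one_pos (M := M) fun y hy => ?_).1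
  refine hM y ?_
  rw [mem_ball, dist_eq_norm] at hy
  linarith [norm_sub_norm_le y x]

theorem exists_rieszPot_bound_on_balls {n : ℕ} (hn : 1 ≤ n) {μ : ℝ} (hμ0 : 0 < μ) (hμn : μ < n)
    {F : EuclideanSpace ℝ (Fin n) → ℝ} (hF : Continuous F) (hF0 : ∀ y, 0 ≤ F y)
    (hFi : Integrable F) (R : ℝ) :
    ∃ M, 0 ≤ M ∧ ∀ x : EuclideanSpace ℝ (Fin n), ‖x‖ ≤ R → rieszPot μ F x ≤ M := by
  obtain ⟨M, hM0, hM⟩ := exists_bound_on_balls hF (R + 1)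
  refine ⟨M * ((∫ z in ball (0 : EuclideanSpace ℝ (Fin n)) 1, ‖z‖ ^ (-μ)) * 1 ^ (n - μ)) +
        1 ^ (-μ) * ∫ y, F y, ?_, fun x hx => ?_⟩
  rotate_left
  · rw [rieszPot_eq]
    refine (integrable_mul_norm_sub_rpow hn hμ0.le hμn hFi hF0 one_pos (M := M)
      fun y hy => ?_).2
    refine hM y ?_
    rw [mem_ball, dist_eq_norm] at hy
    linarith [norm_sub_norm_le y x]
  · have h1 : 0 ≤ ∫ y, F y := integral_nonneg hF0
    have h2 : 0 ≤ ∫ z in ball (0 : EuclideanSpace ℝ (Fin n)) 1, ‖z‖ ^ (-μ) :=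
      integral_nonneg fun z => by positivity
    positivity

theorem rieszPot_lower_bound {n : ℕ} (hn : 1 ≤ n) {μ : ℝ} (hμ0 : 0 < μ) (hμn : μ < n)
    {F : EuclideanSpace ℝ (Fin n) → ℝ} (hF : Continuous F) (hF0 : ∀ y, 0 < F y)
    (hFi : Integrable F) :
    ∃ c, 0 < c ∧ ∀ x : EuclideanSpace ℝ (Fin n), c * (‖x‖ + 1) ^ (-μ) ≤ rieszPot μ F x := by
  refine ⟨∫ y in ball (0 : EuclideanSpace ℝ (Fin n)) 1, F y, ?_, fun x => ?_⟩
  · rw [setIntegral_pos_iff_support_of_nonneg_ae (ae_of_all _ fun y => (hF0 y).le)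
      hFi.integrableOn]
    have : Function.support F = Set.univ := by
      ext y; simpa using (hF0 y).ne'
    rw [this, Set.univ_inter]
    exact measure_ball_pos _ _ one_pos
  · have hi := integrable_rieszPot hn hμ0 hμn hF (fun y => (hF0 y).le) hFi x
    rw [rieszPot_eq, ← integral_mul_const]
    refine le_trans ?_ (setIntegral_le_integral (s := ball 0 1) hi (ae_of_all _ fun y => ?_))
    · refine integral_mono_ae (hFi.integrableOn.mul_const _) hi.integrableOn ?_
      have hne : ∀ᵐ y ∂(volume.restrict (ball (0 : EuclideanSpace ℝ (Fin n)) 1)), y ≠ x := by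
        have : Nontrivial (EuclideanSpace ℝ (Fin n)) := by
          apply Module.nontrivial_of_finrank_pos (R := ℝ)
          simpa using Nat.pos_of_ne_zero (Nat.one_le_iff_ne_zero.1 hn)
        refine ae_restrict_of_ae ?_
        exact (measure_eq_zero_iff_ae_notMem.1 (measure_singleton x)).mono fun y hy => hy
      filter_upwards [ae_restrict_mem measurableSet_ball, hne] with y hy hyx
      refine mul_le_mul_of_nonneg_left ?_ (hF0 y).le
      have hpos : 0 < ‖x - y‖ := norm_pos_iff.2 (sub_ne_zero.2 hyx.symm)
      refine Real.rpow_le_rpow_of_nonpos hpos ?_ (by linarith)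
      rw [mem_ball_zero_iff] at hy
      linarith [norm_sub_le x y]
    · exact mul_nonneg (hF0 y).le (by positivity)

theorem abs_rpow_neg_sub_le {μ : ℝ} (hμ : 0 < μ) {a b : ℝ} (ha : 1 ≤ a) (hb : 1 ≤ b) :
    |a ^ (-μ) - b ^ (-μ)| ≤ μ * |a - b| := by
  have := Convex.norm_image_sub_le_of_norm_hasDerivWithin_le (f := fun x : ℝ => x ^ (-μ))
    (f' := fun x => -μ * x ^ (-μ - 1)) (s := Set.Ici 1) (C := μ) (x := b) (y := a)
    (fun x hx => (Real.hasDerivAt_rpow_const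
      (Or.inl (zero_lt_one.trans_le hx).ne')).hasDerivWithinAt) (fun x hx => ?_)
    (convex_Ici 1) hb ha
  · simpa using this
  · rw [norm_mul, norm_neg, Real.norm_of_nonneg hμ.le,
      Real.norm_of_nonneg (Real.rpow_nonneg (zero_le_one.trans hx) _)]
    exact mul_le_of_le_one_right hμ.le (Real.rpow_le_one_of_one_le_of_nonpos hx (by linarith))

/-- The Riesz potential of a locally Lipschitz integrable function is locally Lipschitz: split
the kernel into an integrable compactly supported part and a globally Lipschitz part. -/
theorem rieszPot_lipschitz {n : ℕ} (hn : 1 ≤ n) {μ : ℝ} (hμ0 : 0 < μ) (hμn : μ < n)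
    {F : EuclideanSpace ℝ (Fin n) → ℝ} (hF : Continuous F) (hF0 : ∀ y, 0 ≤ F y)
    (hFi : Integrable F) {b : EuclideanSpace ℝ (Fin n)} {L : ℝ} (hL0 : 0 ≤ L)
    (hL : ∀ y ∈ ball b 2, ∀ y' ∈ ball b 2, |F y - F y'| ≤ L * ‖y - y'‖) :
    ∃ L', 0 ≤ L' ∧ ∀ x ∈ ball b 1, ∀ x' ∈ ball b 1,
      |rieszPot μ F x - rieszPot μ F x'| ≤ L' * ‖x - x'‖ := by
  set k1 : EuclideanSpace ℝ (Fin n) → ℝ := (ball 0 1).indicator fun z => ‖z‖ ^ (-μ) - 1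
  set k2 : EuclideanSpace ℝ (Fin n) → ℝ := fun z => (max ‖z‖ 1) ^ (-μ)
  have hk12 : ∀ z, ‖z‖ ^ (-μ) = k1 z + k2 z := by
    intro z
    by_cases hz : z ∈ ball (0 : EuclideanSpace ℝ (Fin n)) 1
    · simp only [k1, k2, Set.indicator_of_mem hz]
      rw [mem_ball_zero_iff] at hz
      rw [max_eq_right hz.le, Real.one_rpow]
      ring
    · simp only [k1, k2, Set.indicator_of_notMem hz]
      rw [mem_ball_zero_iff, not_lt] at hz
      rw [max_eq_left hz, zero_add]
  have hk1i : Integrable k1 := by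
    rw [integrable_indicator_iff measurableSet_ball]
    refine Integrable.sub ?_ (integrableOn_const measure_ball_lt_top.ne)
    simpa [IntegrableOn] using integrableOn_ball_norm_sub_rpow hn hμn (0 : EuclideanSpace ℝ (Fin n)) 1
  have hk2c : Measurable k2 := (measurable_norm.max measurable_const).pow_const _
  have hk2b : ∀ z, ‖k2 z‖ ≤ 1 := fun z => by
    rw [Real.norm_of_nonneg (by positivity)]
    exact Real.rpow_le_one_of_one_le_of_nonpos (le_max_right _ _) (by linarith)
  have hk2i : ∀ x, Integrable fun y => F y * k2 (x - y) := fun x =>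
    hFi.mul_bdd (c := 1) (hk2c.comp (measurable_const.sub measurable_id)).aestronglyMeasurable
      (ae_of_all _ fun y => hk2b _)
  have hFk1 : ∀ x, Integrable fun y => F y * k1 (x - y) := fun x => by
    refine ((integrable_rieszPot hn hμ0 hμn hF hF0 hFi x).sub (hk2i x)).congr
      (ae_of_all _ fun y => ?_)
    simp only [Pi.sub_apply, hk12]
    ring
  have hFk1' : ∀ x, Integrable fun z => F (x - z) * k1 z := fun x => by
    simpa using (hFk1 x).comp_sub_left x
  have hdec : ∀ x, rieszPot μ F x = (∫ z, F (x - z) * k1 z) + ∫ y, F y * k2 (x - y) := by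
    intro x
    rw [rieszPot_eq, ← integral_sub_left_eq_self (fun z => F (x - z) * k1 z) volume x]
    simp only [sub_sub_cancel]
    rw [← integral_add (hFk1 x) (hk2i x)]
    refine integral_congr_ae (ae_of_all _ fun y => ?_)
    simp only [hk12]
    ring
  refine ⟨L * (∫ z, ‖k1 z‖) + μ * ∫ y, F y, ?_, fun x hx x' hx' => ?_⟩
  · have h1 : 0 ≤ ∫ y, F y := integral_nonneg hF0
    have h2 : 0 ≤ ∫ z, ‖k1 z‖ := integral_nonneg fun z => norm_nonneg _
    positivity
  have e1 : |(∫ z, F (x - z) * k1 z) - ∫ z, F (x' - z) * k1 z| ≤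
      L * (∫ z, ‖k1 z‖) * ‖x - x'‖ := by
    rw [← integral_sub (hFk1' x) (hFk1' x'), mul_right_comm, ← integral_const_mul,
      ← Real.norm_eq_abs]
    refine norm_integral_le_of_norm_le (hk1i.norm.const_mul _) (ae_of_all _ fun z => ?_)
    rw [← sub_mul, norm_mul]
    by_cases hz : z ∈ ball (0 : EuclideanSpace ℝ (Fin n)) 1
    · refine mul_le_mul_of_nonneg_right ?_ (norm_nonneg _)
      rw [mem_ball_zero_iff] at hz
      have aux : ∀ w ∈ ball b 1, w - z ∈ ball b 2 := by
        intro w hw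
        rw [mem_ball, dist_eq_norm] at hw ⊢
        rw [sub_right_comm]
        linarith [norm_sub_le (w - b) z]
      have := hL (x - z) (aux x hx) (x' - z) (aux x' hx')
      rwa [sub_sub_sub_cancel_right] at this
    · simp [k1, Set.indicator_of_notMem hz]
  have e2 : |(∫ y, F y * k2 (x - y)) - ∫ y, F y * k2 (x' - y)| ≤
      μ * (∫ y, F y) * ‖x - x'‖ := by
    rw [← integral_sub (hk2i x) (hk2i x'), mul_right_comm, ← integral_const_mul,
      ← Real.norm_eq_abs]
    refine norm_integral_le_of_norm_le (hFi.const_mul _) (ae_of_all _ fun y => ?_)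
    rw [← mul_sub, norm_mul, Real.norm_of_nonneg (hF0 y), mul_comm]
    refine mul_le_mul_of_nonneg_right ?_ (hF0 y)
    refine (abs_rpow_neg_sub_le hμ0 (le_max_right _ _) (le_max_right _ _)).trans ?_
    refine mul_le_mul_of_nonneg_left ?_ hμ0.le
    refine (abs_max_sub_max_le_abs _ _ _).trans ((abs_norm_sub_norm_le _ _).trans_eq ?_)
    rw [sub_sub_sub_cancel_right]
  rw [hdec x, hdec x', add_sub_add_comm, add_mul]
  exact (abs_add_le _ _).trans (add_le_add e1 e2)

/-- The normalised logarithmic potential of a measure. -/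
def logPot {n : ℕ} (ν : Measure (EuclideanSpace ℝ (Fin n))) (x : EuclideanSpace ℝ (Fin n)) : ℝ :=
  ∫ y, Real.log ((‖y‖ + 1) / ‖x - y‖) ∂ν

section LogPotential

variable {n : ℕ} {ν : Measure (EuclideanSpace ℝ (Fin n))} [IsFiniteMeasure ν]

theorem integrable_logPot (hI : ∀ x, Integrable (fun y => ‖x - y‖⁻¹) ν)
    (x : EuclideanSpace ℝ (Fin n)) :
    Integrable (fun y => Real.log ((‖y‖ + 1) / ‖x - y‖)) ν := by
  have hdom : Integrable (fun y => ‖x‖ + (1 + ‖x‖) * ‖x - y‖⁻¹) ν :=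
    (integrable_const _).add ((hI x).const_mul _)
  refine hdom.mono' ?_ (ae_of_all _ fun y => ?_)
  · exact Measurable.aestronglyMeasurable (by fun_prop)
  rcases eq_or_ne x y with rfl | hxy
  · simp
  have hp : 0 < ‖x - y‖ := norm_pos_iff.2 (sub_ne_zero.2 hxy)
  have hy : 0 < ‖y‖ + 1 := by positivity
  have hi : 0 < ‖x - y‖⁻¹ := inv_pos.2 hp
  have hx := norm_nonneg x
  rw [Real.norm_eq_abs, abs_le]
  constructor
  · have h1 : Real.log (‖x - y‖ / (‖y‖ + 1)) ≤ ‖x - y‖ / (‖y‖ + 1) - 1 :=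
      Real.log_le_sub_one_of_pos (by positivity)
    have h2 : ‖x - y‖ / (‖y‖ + 1) ≤ ‖x‖ + 1 := by
      rw [div_le_iff₀ hy]
      nlinarith [norm_sub_le x y, norm_nonneg y, mul_nonneg hx (norm_nonneg y)]
    have h3 : Real.log ((‖y‖ + 1) / ‖x - y‖) = - Real.log (‖x - y‖ / (‖y‖ + 1)) := by
      rw [← Real.log_inv, inv_div]
    rw [h3]
    have : 0 ≤ (1 + ‖x‖) * ‖x - y‖⁻¹ := by positivity
    linarith
  · have h1 := Real.log_le_sub_one_of_pos (show 0 < (‖y‖ + 1) / ‖x - y‖ by positivity)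
    have h2 : (‖y‖ + 1) / ‖x - y‖ ≤ 1 + (1 + ‖x‖) * ‖x - y‖⁻¹ := by
      rw [div_le_iff₀ hp, add_mul, mul_assoc, inv_mul_cancel₀ hp.ne']
      have := norm_sub_norm_le y x
      rw [norm_sub_rev] at this
      linarith
    linarith

theorem logPot_lower_bound (hI : ∀ x, Integrable (fun y => ‖x - y‖⁻¹) ν)
    (x : EuclideanSpace ℝ (Fin n)) : -(ν.real Set.univ * Real.log (1 + ‖x‖)) ≤ logPot ν x := by
  have : ∫ _, -Real.log (1 + ‖x‖) ∂ν = -(ν.real Set.univ * Real.log (1 + ‖x‖)) := by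
    simp
  rw [← this]
  refine integral_mono (integrable_const _) (integrable_logPot hI x) fun y => ?_
  have hx := norm_nonneg x
  simp only
  rcases eq_or_ne x y with rfl | hxy
  · simp only [sub_self, norm_zero, div_zero, Real.log_zero, Left.neg_nonpos_iff]
    exact Real.log_nonneg (by linarith)
  have hp : 0 < ‖x - y‖ := norm_pos_iff.2 (sub_ne_zero.2 hxy)
  rw [← Real.log_inv]
  refine Real.log_le_log (by positivity) ?_
  rw [le_div_iff₀ hp, inv_mul_le_iff₀ (by positivity)]
  nlinarith [norm_sub_le x y, norm_nonneg y, mul_nonneg hx (norm_nonneg y)]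

theorem logPot_sub [NullSingletonClass ν] (hI : ∀ x, Integrable (fun y => ‖x - y‖⁻¹) ν)
    (x x' : EuclideanSpace ℝ (Fin n)) :
    Integrable (fun y => Real.log (‖x' - y‖ / ‖x - y‖)) ν ∧
    logPot ν x - logPot ν x' = ∫ y, Real.log (‖x' - y‖ / ‖x - y‖) ∂ν := by
  have hae : (fun y => Real.log ((‖y‖ + 1) / ‖x - y‖) - Real.log ((‖y‖ + 1) / ‖x' - y‖)) =ᵐ[ν]
      fun y => Real.log (‖x' - y‖ / ‖x - y‖) := by
    have h1 : ∀ᵐ y ∂ν, y ≠ x := measure_eq_zero_iff_ae_notMem.1 (measure_singleton x)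
    have h2 : ∀ᵐ y ∂ν, y ≠ x' := measure_eq_zero_iff_ae_notMem.1 (measure_singleton x')
    filter_upwards [h1, h2] with y hy hy'
    have hp : ‖x - y‖ ≠ 0 := norm_ne_zero_iff.2 (sub_ne_zero.2 hy.symm)
    have hp' : ‖x' - y‖ ≠ 0 := norm_ne_zero_iff.2 (sub_ne_zero.2 hy'.symm)
    have hy1 : ‖y‖ + 1 ≠ 0 := by positivity
    rw [Real.log_div hy1 hp, Real.log_div hy1 hp', Real.log_div hp' hp]
    ring
  have hi := (integrable_logPot hI x).sub (integrable_logPot hI x')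
  refine ⟨hi.congr hae, ?_⟩
  rw [logPot, logPot, ← integral_sub (integrable_logPot hI x) (integrable_logPot hI x')]
  exact integral_congr_ae hae

theorem measurable_logPot : Measurable (logPot ν) := by
  have : StronglyMeasurable fun p : EuclideanSpace ℝ (Fin n) × EuclideanSpace ℝ (Fin n) =>
      Real.log ((‖p.2‖ + 1) / ‖p.1 - p.2‖) := Measurable.stronglyMeasurable (by fun_prop)
  exact this.integral_prod_right.measurable

theorem log_norm_div_le {E : Type*} [NormedAddCommGroup E] (a b : E) :
    Real.log (‖a‖ / ‖b‖) ≤ ‖a - b‖ * ‖b‖⁻¹ := by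
  rcases eq_or_ne a 0 with rfl | ha
  · simp only [norm_zero, zero_div, Real.log_zero]
    positivity
  rcases eq_or_ne b 0 with rfl | hb
  · simp
  have ha' := norm_pos_iff.2 ha
  have hb' := norm_pos_iff.2 hb
  refine (Real.log_le_sub_one_of_pos (by positivity)).trans ?_
  rw [← div_eq_mul_inv, sub_le_iff_le_add, div_add_one hb'.ne']
  gcongr
  linarith [norm_sub_norm_le a b]

theorem smul_sub_sub_norm {E : Type*} [NormedAddCommGroup E] [NormedSpace ℝ E] (x y : E) {t : ℝ}
    (ht1 : t ≤ 1) : ‖(t • x - y) - (x - y)‖ = (1 - t) * ‖x‖ := by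
  have : (t • x - y) - (x - y) = -((1 - t) • x) := by rw [sub_smul, one_smul]; abel
  rw [this, norm_neg, norm_smul, Real.norm_of_nonneg (by linarith)]

theorem abs_logPot_smul_sub_le [NullSingletonClass ν] (hI : ∀ x, Integrable (fun y => ‖x - y‖⁻¹) ν) {K : ℝ}
    (hK : ∀ x : EuclideanSpace ℝ (Fin n), ∫ y, ‖x‖ * ‖x - y‖⁻¹ ∂ν ≤ K) {t : ℝ} (ht0 : 0 < t)
    (ht1 : t ≤ 1) (x : EuclideanSpace ℝ (Fin n)) :
    |logPot ν (t • x) - logPot ν x| ≤ t⁻¹ * K := by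
  have key : ∀ x' : EuclideanSpace ℝ (Fin n), 0 ≤ K := fun x' =>
    (integral_nonneg fun y => by positivity).trans (hK x')
  have hK0 := key 0
  have hti : 1 ≤ t⁻¹ := (one_le_inv₀ ht0).2 ht1
  rw [abs_le]
  constructor
  · have hs := logPot_sub hI x (t • x)
    have h1 : logPot ν x - logPot ν (t • x) ≤ (1 - t) * K := by
      rw [hs.2]
      refine le_trans ?_ (mul_le_mul_of_nonneg_left (hK x) (by linarith))
      rw [← integral_const_mul]
      refine integral_mono hs.1 (((hI x).const_mul _).const_mul _) fun y => ?_
      refine (log_norm_div_le _ _).trans_eq ?_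
      rw [smul_sub_sub_norm _ _ ht1, mul_assoc]
    nlinarith
  · have hs := logPot_sub hI (t • x) x
    rw [hs.2]
    refine le_trans ?_ (mul_le_mul_of_nonneg_left (hK (t • x)) (by positivity))
    rw [← integral_const_mul]
    refine integral_mono hs.1 (((hI (t • x)).const_mul _).const_mul _) fun y => ?_
    refine (log_norm_div_le _ _).trans ?_
    rw [norm_sub_rev, smul_sub_sub_norm _ _ ht1, norm_smul, Real.norm_of_nonneg ht0.le, ← mul_assoc,
      ← mul_assoc, inv_mul_cancel₀ ht0.ne', one_mul]
    gcongr
    nlinarith [norm_nonneg x]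

theorem hasDerivAt_log_norm_sub_smul {E : Type*} [NormedAddCommGroup E] [InnerProductSpace ℝ E]
    {a : E} (ha : a ≠ 0) (x : E) :
    HasDerivAt (fun s : ℝ => Real.log (‖a - s • x‖ / ‖a‖)) (-(inner ℝ x a / ‖a‖ ^ 2)) 0 := by
  have ha' : ‖a‖ ≠ 0 := norm_ne_zero_iff.2 ha
  have hN : HasDerivAt (fun s : ℝ => ‖a‖ ^ 2 - 2 * (s * inner ℝ x a) + s ^ 2 * ‖x‖ ^ 2)
      (-(2 * inner ℝ x a)) 0 := by
    have h := (((hasDerivAt_id (0 : ℝ)).mul_const (inner ℝ x a)).const_mul 2).const_sub (‖a‖ ^ 2)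
      |>.add (((hasDerivAt_id (0 : ℝ)).pow 2).mul_const (‖x‖ ^ 2))
    exact h.congr_deriv (by simp)
  have h2 := ((hN.div_const (‖a‖ ^ 2)).log (by simp [ha'])).const_mul (1 / 2 : ℝ)
  have heq : (fun s : ℝ => Real.log (‖a - s • x‖ / ‖a‖)) = fun s => 1 / 2 *
      Real.log ((‖a‖ ^ 2 - 2 * (s * inner ℝ x a) + s ^ 2 * ‖x‖ ^ 2) / ‖a‖ ^ 2) := by
    ext s
    have : ‖a - s • x‖ ^ 2 = ‖a‖ ^ 2 - 2 * (s * inner ℝ x a) + s ^ 2 * ‖x‖ ^ 2 := by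
      rw [norm_sub_sq_real, inner_smul_right, real_inner_comm, norm_smul, mul_pow,
        Real.norm_eq_abs, sq_abs]
    rw [← this, ← div_pow, Real.log_pow]
    push_cast
    ring
  rw [heq]
  refine h2.congr_deriv ?_
  simp only [zero_mul, mul_zero, sub_zero, ne_eq, OfNat.ofNat_ne_zero, not_false_eq_true,
    zero_pow, add_zero]
  field_simp

theorem abs_inner_div_sq_le {E : Type*} [NormedAddCommGroup E] [InnerProductSpace ℝ E] (x a : E) :
    |inner ℝ x a / ‖a‖ ^ 2| ≤ ‖x‖ * ‖a‖⁻¹ := by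
  rcases eq_or_ne a 0 with rfl | ha
  · simp
  have ha' := norm_pos_iff.2 ha
  rw [abs_div, abs_of_nonneg (sq_nonneg ‖a‖), div_le_iff₀ (by positivity)]
  refine (abs_real_inner_le_norm x a).trans_eq ?_
  field_simp

theorem ae_prod_ne [NullSingletonClass ν] : ∀ᵐ p ∂(ν.prod ν), p.1 ≠ p.2 := by
  have hm : MeasurableSet {p : EuclideanSpace ℝ (Fin n) × EuclideanSpace ℝ (Fin n) | p.1 = p.2} :=
    measurableSet_eq_fun measurable_fst measurable_snd
  refine measure_eq_zero_iff_ae_notMem.1 ((Measure.measure_prod_null hm).2 (ae_of_all _ fun x => ?_))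
  have : Prod.mk x ⁻¹' {p : EuclideanSpace ℝ (Fin n) × EuclideanSpace ℝ (Fin n) | p.1 = p.2}
      = {x} := by
    ext y; simp [eq_comm]
  simp only [this, Pi.zero_apply]
  exact measure_singleton x

theorem integrable_prod_weight (hI : ∀ x, Integrable (fun y => ‖x - y‖⁻¹) ν) {K : ℝ}
    (hK : ∀ x : EuclideanSpace ℝ (Fin n), ∫ y, ‖x‖ * ‖x - y‖⁻¹ ∂ν ≤ K) :
    Integrable (fun p : EuclideanSpace ℝ (Fin n) × EuclideanSpace ℝ (Fin n) =>
      ‖p.1‖ * ‖p.1 - p.2‖⁻¹) (ν.prod ν) := by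
  have hm : StronglyMeasurable (fun p : EuclideanSpace ℝ (Fin n) × EuclideanSpace ℝ (Fin n) =>
      ‖p.1‖ * ‖p.1 - p.2‖⁻¹) := Measurable.stronglyMeasurable (by fun_prop)
  rw [integrable_prod_iff hm.aestronglyMeasurable]
  refine ⟨ae_of_all _ fun x => (hI x).const_mul ‖x‖, ?_⟩
  refine (integrable_const K).mono' hm.norm.integral_prod_right.aestronglyMeasurable
    (ae_of_all _ fun x => ?_)
  rw [Real.norm_of_nonneg (integral_nonneg fun y => norm_nonneg _)]
  refine le_trans (le_of_eq ?_) (hK x)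
  refine integral_congr_ae (ae_of_all _ fun y => ?_)
  exact Real.norm_of_nonneg (by positivity)

theorem integral_prod_virial [NullSingletonClass ν] (hI : ∀ x, Integrable (fun y => ‖x - y‖⁻¹) ν) {K : ℝ}
    (hK : ∀ x : EuclideanSpace ℝ (Fin n), ∫ y, ‖x‖ * ‖x - y‖⁻¹ ∂ν ≤ K) :
    ∫ p : EuclideanSpace ℝ (Fin n) × EuclideanSpace ℝ (Fin n),
      inner ℝ p.1 (p.1 - p.2) / ‖p.1 - p.2‖ ^ 2 ∂(ν.prod ν) = (ν.real Set.univ) ^ 2 / 2 := by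
  set f := fun p : EuclideanSpace ℝ (Fin n) × EuclideanSpace ℝ (Fin n) =>
      inner ℝ p.1 (p.1 - p.2) / ‖p.1 - p.2‖ ^ 2 with hf
  have hm : Measurable f := by fun_prop
  have hfi : Integrable f (ν.prod ν) := by
    refine (integrable_prod_weight hI hK).mono' hm.aestronglyMeasurable (ae_of_all _ fun p => ?_)
    exact abs_inner_div_sq_le _ _
  have hne : ∀ᵐ p ∂(ν.prod ν), p.1 ≠ p.2 := ae_prod_ne
  have hsum : ∫ p, (f p + f p.swap) ∂(ν.prod ν) = (ν.real Set.univ) ^ 2 := by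
    have : (fun p => f p + f p.swap) =ᵐ[ν.prod ν] fun _ => (1 : ℝ) := by
      filter_upwards [hne] with p hp
      have hp' : ‖p.1 - p.2‖ ≠ 0 := norm_ne_zero_iff.2 (sub_ne_zero.2 hp)
      simp only [hf, Prod.fst_swap, Prod.snd_swap]
      rw [norm_sub_rev p.2 p.1, ← add_div, div_eq_one_iff_eq (by positivity),
        ← real_inner_self_eq_norm_sq, ← neg_sub p.1 p.2, inner_neg_right, ← sub_eq_add_neg,
        ← inner_sub_left]
    rw [integral_congr_ae this]
    simp [Measure.real, ← Set.univ_prod_univ, Measure.prod_prod, sq]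
  have hadd := integral_add hfi hfi.swap
  rw [show ∫ p, (f ∘ Prod.swap) p ∂(ν.prod ν) = ∫ p, f p ∂(ν.prod ν) from
    integral_prod_swap f] at hadd
  simp only [Function.comp_apply] at hadd
  linarith

end LogPotential

section Pohozaev

variable {n : ℕ} {ν : Measure (EuclideanSpace ℝ (Fin n))} [IsFiniteMeasure ν]

/-- The Pohozaev inequality: if the potential does not increase on average under the dilations
`u ↦ u(t·) + log t`, `0 < t < 1`, then the total mass is at most two. -/
theorem mass_le_two_of_dilation [NullSingletonClass ν]
    (hI : ∀ x, Integrable (fun y => ‖x - y‖⁻¹) ν) {K : ℝ}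
    (hK : ∀ x : EuclideanSpace ℝ (Fin n), ∫ y, ‖x‖ * ‖x - y‖⁻¹ ∂ν ≤ K)
    (hdil : ∀ t ∈ Set.Ioo (0 : ℝ) 1,
      ∫ x, (logPot ν (t • x) - logPot ν x + Real.log t) ∂ν ≤ 0) :
    ν.real Set.univ ≤ 2 := by
  set g := fun p : EuclideanSpace ℝ (Fin n) × EuclideanSpace ℝ (Fin n) =>
      ‖p.1‖ * ‖p.1 - p.2‖⁻¹
  have hg : Integrable g (ν.prod ν) := integrable_prod_weight hI hK
  set ψ := fun (ε : ℝ) (p : EuclideanSpace ℝ (Fin n) × EuclideanSpace ℝ (Fin n)) =>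
      Real.log (‖(1 - ε) • p.1 - p.2‖ / ‖p.1 - p.2‖) / ε
  set Ψ := fun (ε : ℝ) (p : EuclideanSpace ℝ (Fin n) × EuclideanSpace ℝ (Fin n)) =>
      max (ψ ε p) (-g p)
  have hψm : ∀ ε, Measurable (ψ ε) := fun ε => by fun_prop
  have hgm : Measurable g := by fun_prop
  have hΨm : ∀ ε, Measurable (Ψ ε) := fun ε => (hψm ε).max hgm.neg
  have hg0 : ∀ p, 0 ≤ g p := fun p => by positivity
  have hψg : ∀ ε ∈ Set.Ioo (0 : ℝ) 1, ∀ p, ψ ε p ≤ g p := by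
    intro ε hε p
    simp only [ψ, g]
    rw [div_le_iff₀ hε.1]
    refine (log_norm_div_le _ _).trans_eq ?_
    rw [smul_sub_sub_norm _ _ (by linarith [hε.1])]
    ring
  have hΨg : ∀ ε ∈ Set.Ioo (0 : ℝ) 1, ∀ p, ‖Ψ ε p‖ ≤ g p := by
    intro ε hε p
    rw [Real.norm_eq_abs, abs_le]
    exact ⟨le_max_right _ _, max_le (hψg ε hε p) (by linarith [hg0 p])⟩
  have hev : ∀ᶠ ε in 𝓝[>] (0 : ℝ), ε ∈ Set.Ioo (0 : ℝ) 1 := Ioo_mem_nhdsGT one_pos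
  have hlim : Tendsto (fun ε => ∫ p, Ψ ε p ∂(ν.prod ν)) (𝓝[>] (0 : ℝ))
      (𝓝 (-((ν.real Set.univ) ^ 2 / 2))) := by
    rw [← integral_prod_virial hI hK, ← integral_neg]
    refine tendsto_integral_filter_of_dominated_convergence g
      (Eventually.of_forall fun ε => (hΨm ε).aestronglyMeasurable) ?_ hg ?_
    · filter_upwards [hev] with ε hε using ae_of_all _ (hΨg ε hε)
    · filter_upwards [ae_prod_ne (ν := ν)] with p hp
      have hd := (hasDerivAt_log_norm_sub_smul (sub_ne_zero.2 hp) p.1).tendsto_slope_zero_right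
      have h1 : Tendsto (fun ε => ψ ε p) (𝓝[>] (0 : ℝ))
          (𝓝 (-(inner ℝ p.1 (p.1 - p.2) / ‖p.1 - p.2‖ ^ 2))) := by
        refine hd.congr fun ε => ?_
        have hne : ‖p.1 - p.2‖ ≠ 0 := norm_ne_zero_iff.2 (sub_ne_zero.2 hp)
        have hsub : (1 - ε) • p.1 - p.2 = p.1 - p.2 - ε • p.1 := by
          rw [sub_smul, one_smul]; abel
        simp only [ψ, hsub, zero_add, zero_smul, sub_zero, div_self hne, Real.log_one,
          smul_eq_mul, div_eq_inv_mul]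
      have h2 := h1.max (tendsto_const_nhds (x := -g p))
      rwa [max_eq_left] at h2
      exact neg_le_neg ((le_abs_self _).trans (abs_inner_div_sq_le _ _))
  have hlog : Tendsto (fun ε : ℝ => ν.real Set.univ * (Real.log (1 - ε) / ε)) (𝓝[>] (0 : ℝ))
      (𝓝 (ν.real Set.univ * (-1))) := by
    refine Tendsto.const_mul _ ?_
    have hd : HasDerivAt (fun ε : ℝ => Real.log (1 - ε)) (-1) 0 := by
      have := ((hasDerivAt_id (0 : ℝ)).const_sub 1).log (by simp)
      simpa using this
    refine hd.tendsto_slope_zero_right.congr fun ε => ?_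
    simp [div_eq_inv_mul]
  have hle : ∀ᶠ ε in 𝓝[>] (0 : ℝ),
      ν.real Set.univ * (Real.log (1 - ε) / ε) ≤ ∫ p, Ψ ε p ∂(ν.prod ν) := by
    filter_upwards [hev] with ε hε
    have ht0 : 0 < 1 - ε := by linarith [hε.2]
    have ht1 : 1 - ε ≤ 1 := by linarith [hε.1]
    have hφi : Integrable (fun x => logPot ν ((1 - ε) • x) - logPot ν x) ν := by
      refine (integrable_const ((1 - ε)⁻¹ * K)).mono' ?_ (ae_of_all _ fun x =>
        abs_logPot_smul_sub_le hI hK ht0 ht1 x)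
      exact ((measurable_logPot.comp (measurable_const_smul _)).sub
        measurable_logPot).aestronglyMeasurable
    have h1 := hdil (1 - ε) ⟨ht0, by linarith [hε.1]⟩
    rw [integral_add hφi (integrable_const _), integral_const, smul_eq_mul] at h1
    have hΨi : Integrable (Ψ ε) (ν.prod ν) :=
      hg.mono' (hΨm ε).aestronglyMeasurable (ae_of_all _ (hΨg ε hε))
    have h2 : ∫ x, -(logPot ν ((1 - ε) • x) - logPot ν x) / ε ∂ν ≤ ∫ p, Ψ ε p ∂(ν.prod ν) := by
      rw [integral_prod _ hΨi]
      refine integral_mono (hφi.neg.div_const ε) hΨi.integral_prod_left fun x => ?_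
      have hs := logPot_sub hI x ((1 - ε) • x)
      simp only [neg_sub]
      rw [hs.2, ← integral_div]
      refine integral_mono (hs.1.div_const ε) ?_ fun y => le_max_left _ _
      refine ((hI x).const_mul ‖x‖).mono' ?_ (ae_of_all _ fun y => hΨg ε hε (x, y))
      exact ((hΨm ε).comp measurable_prodMk_left).aestronglyMeasurable
    rw [integral_div, integral_neg] at h2
    refine le_trans ?_ h2
    rw [← mul_div_assoc]
    exact div_le_div_of_nonneg_right (by linarith) hε.1.le
  have := le_of_tendsto_of_tendsto hlog hlim hle
  by_contra! h
  nlinarith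

end Pohozaev

theorem integrableOn_log_div_norm_sub {n : ℕ} {ν : Measure (EuclideanSpace ℝ (Fin n))}
    (hI : ∀ x, Integrable (fun y => ‖x - y‖⁻¹) ν)
    {x₀ y : EuclideanSpace ℝ (Fin n)} {d : ℝ} (hy : y ∈ ball x₀ d) :
    IntegrableOn (fun z => Real.log (3 * d / ‖y - z‖)) (ball x₀ (2 * d)) ν ∧
      ∀ z ∈ ball x₀ (2 * d), 0 ≤ Real.log (3 * d / ‖y - z‖) := by
  have hd : 0 < d := pos_of_mem_ball hy
  have h0 : ∀ z ∈ ball x₀ (2 * d), 0 ≤ Real.log (3 * d / ‖y - z‖) := by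
    intro z hz
    rcases eq_or_ne y z with rfl | hyz
    · simp
    have hp : 0 < ‖y - z‖ := norm_pos_iff.2 (sub_ne_zero.2 hyz)
    refine Real.log_nonneg ?_
    rw [one_le_div hp, ← dist_eq_norm]
    rw [mem_ball] at hy hz
    linarith [dist_triangle_right y z x₀]
  refine ⟨?_, h0⟩
  refine Integrable.mono' ((hI y).const_mul (3 * d)).integrableOn
    (Measurable.aestronglyMeasurable (by fun_prop)) ?_
  filter_upwards [ae_restrict_mem measurableSet_ball] with z hz
  rw [Real.norm_of_nonneg (h0 z hz)]
  rcases eq_or_ne y z with rfl | hyz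
  · simp
  have hp : 0 < ‖y - z‖ := norm_pos_iff.2 (sub_ne_zero.2 hyz)
  have := Real.log_le_sub_one_of_pos (show 0 < 3 * d / ‖y - z‖ by positivity)
  rw [div_eq_mul_inv] at this ⊢
  linarith

section Regularity

variable {n : ℕ} {ν : Measure (EuclideanSpace ℝ (Fin n))} [IsFiniteMeasure ν]

theorem logPot_sub_le [NullSingletonClass ν] (hI : ∀ x, Integrable (fun y => ‖x - y‖⁻¹) ν)
    {x₀ y y' : EuclideanSpace ℝ (Fin n)} {d : ℝ} (hy : y ∈ ball x₀ d) (hy' : y' ∈ ball x₀ d) :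
    logPot ν y - logPot ν y' ≤
      ν.real Set.univ * Real.log 3 + ∫ z in ball x₀ (2 * d), Real.log (3 * d / ‖y - z‖) ∂ν := by
  have hd : 0 < d := pos_of_mem_ball hy
  obtain ⟨h1, h2⟩ := logPot_sub hI y y'
  obtain ⟨hi, h0⟩ := integrableOn_log_div_norm_sub hI hy
  have hl3 : 0 ≤ Real.log 3 := Real.log_nonneg (by norm_num)
  have e : ν.real Set.univ * Real.log 3 = ∫ _, Real.log 3 ∂ν := by simp
  rw [h2, e, ← integral_indicator measurableSet_ball, ← integral_add (integrable_const _)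
    (hi.integrable_indicator measurableSet_ball)]
  refine integral_mono_ae h1 ((integrable_const _).add
    (hi.integrable_indicator measurableSet_ball)) ?_
  have hae : ∀ a : EuclideanSpace ℝ (Fin n), ∀ᵐ z ∂ν, z ≠ a := fun a => by
    simp [ae_iff]
  filter_upwards [hae y, hae y'] with z hz hz'
  have hp : 0 < ‖y - z‖ := norm_pos_iff.2 (sub_ne_zero.2 hz.symm)
  have hp' : 0 < ‖y' - z‖ := norm_pos_iff.2 (sub_ne_zero.2 hz'.symm)
  rw [mem_ball] at hy hy'
  by_cases hzB : z ∈ ball x₀ (2 * d)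
  · rw [Set.indicator_of_mem hzB]
    have : Real.log (‖y' - z‖ / ‖y - z‖) ≤ Real.log (3 * d / ‖y - z‖) := by
      refine Real.log_le_log (by positivity) ?_
      gcongr
      rw [mem_ball] at hzB
      rw [← dist_eq_norm]
      linarith [dist_triangle_right y' z x₀]
    linarith
  · rw [Set.indicator_of_notMem hzB, add_zero]
    refine Real.log_le_log (by positivity) ?_
    rw [div_le_iff₀ hp, ← dist_eq_norm, ← dist_eq_norm]
    rw [mem_ball, not_lt] at hzB
    have t1 := dist_triangle_right y' y x₀
    have t2 := dist_triangle y' y z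
    have t3 := dist_triangle_left z x₀ y
    linarith

theorem exp_integral_log_le [NullSingletonClass ν] (hI : ∀ x, Integrable (fun y => ‖x - y‖⁻¹) ν)
    {γ κ₀ : ℝ} (hIκ : ∀ x, Integrable (fun y => ‖x - y‖ ^ (-κ₀)) ν)
    {x₀ y : EuclideanSpace ℝ (Fin n)} {d : ℝ} (hy : y ∈ ball x₀ d)
    (hM0 : 0 < ν.real (ball x₀ (2 * d))) (hM : γ * ν.real (ball x₀ (2 * d)) ≤ κ₀) :
    Real.exp (γ * ∫ z in ball x₀ (2 * d), Real.log (3 * d / ‖y - z‖) ∂ν) ≤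
      (ν.real (ball x₀ (2 * d)))⁻¹ *
        ((3 * d) ^ κ₀ * ∫ z in ball x₀ (2 * d), ‖y - z‖ ^ (-κ₀) ∂ν) := by
  have hd : 0 < d := pos_of_mem_ball hy
  obtain ⟨hi, h0⟩ := integrableOn_log_div_norm_sub hI hy
  set B := ball x₀ (2 * d)
  set f := fun z => κ₀ * Real.log (3 * d / ‖y - z‖)
  have hae : ∀ᵐ z ∂ν, z ≠ y := by simp [ae_iff]
  have hexp : ∀ᵐ z ∂(ν.restrict B), Real.exp (f z) = (3 * d) ^ κ₀ * ‖y - z‖ ^ (-κ₀) := by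
    filter_upwards [ae_restrict_of_ae hae] with z hz
    have hp : 0 < ‖y - z‖ := norm_pos_iff.2 (sub_ne_zero.2 hz.symm)
    simp only [f]
    rw [mul_comm, ← Real.rpow_def_of_pos (by positivity), Real.div_rpow (by positivity) hp.le,
      Real.rpow_neg hp.le, div_eq_mul_inv]
  have hei : IntegrableOn (fun z => Real.exp (f z)) B ν :=
    (((hIκ y).const_mul ((3 * d) ^ κ₀)).integrableOn (s := B)).congr
      (hexp.mono fun z hz => hz.symm)
  have hνB : ν B ≠ 0 := fun h => by simp [Measure.real, h] at hM0
  have hJ := ConvexOn.map_set_average_le convexOn_exp Real.continuous_exp.continuousOn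
    isClosed_univ hνB (measure_ne_top ν B) (by simp) (hi.const_mul κ₀) hei
  rw [setAverage_eq, setAverage_eq, smul_eq_mul, smul_eq_mul] at hJ
  rw [← integral_const_mul ((3 * d) ^ κ₀), ← integral_congr_ae hexp]
  refine le_trans (Real.exp_le_exp.2 ?_) hJ
  rw [integral_const_mul, ← mul_assoc]
  refine mul_le_mul_of_nonneg_right ?_ (setIntegral_nonneg measurableSet_ball h0)
  rw [inv_mul_eq_div, le_div_iff₀ hM0]
  exact hM

theorem setIntegral_ball_norm_sub_rpow_le (hn : 1 ≤ n) {s : ℝ} (hs : s < n)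
    {x₀ z : EuclideanSpace ℝ (Fin n)} {d : ℝ} (hd : 0 < d) (hz : z ∈ ball x₀ (2 * d)) :
    IntegrableOn (fun y => ‖z - y‖ ^ (-s)) (ball x₀ d) ∧
    ∫ y in ball x₀ d, ‖z - y‖ ^ (-s) ≤
      (∫ z in ball (0 : EuclideanSpace ℝ (Fin n)) 1, ‖z‖ ^ (-s)) * (3 * d) ^ (n - s) := by
  have hsub : ball x₀ d ⊆ ball z (3 * d) := by
    refine ball_subset_ball' ?_
    rw [mem_ball'] at hz
    linarith
  have hi := integrableOn_ball_norm_sub_rpow hn hs z (3 * d)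
  refine ⟨hi.mono_set hsub, ?_⟩
  rw [← setIntegral_ball_norm_sub_rpow z (by positivity)]
  exact setIntegral_mono_set hi (ae_of_all _ fun y => by positivity) hsub.eventuallyLE

theorem rpow_neg_mul_rpow_neg_le {a b s t : ℝ} (ha : 0 < a) (hb : 0 < b) (hs : 0 ≤ s)
    (ht : 0 ≤ t) : a ^ (-s) * b ^ (-t) ≤ a ^ (-(s + t)) + b ^ (-(s + t)) := by
  rcases le_total a b with h | h
  · have : b ^ (-t) ≤ a ^ (-t) := Real.rpow_le_rpow_of_nonpos ha h (by linarith)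
    have h2 : a ^ (-s) * b ^ (-t) ≤ a ^ (-s) * a ^ (-t) := by gcongr
    rw [← Real.rpow_add ha, ← neg_add] at h2
    have : 0 < b ^ (-(s + t)) := by positivity
    linarith
  · have : a ^ (-s) ≤ b ^ (-s) := Real.rpow_le_rpow_of_nonpos hb h (by linarith)
    have h2 : a ^ (-s) * b ^ (-t) ≤ b ^ (-s) * b ^ (-t) := by gcongr
    rw [← Real.rpow_add hb, ← neg_add] at h2
    have : 0 < a ^ (-(s + t)) := by positivity
    linarith

theorem integral_integral_kernel_le (hn : 2 ≤ n) {κ κ₀ : ℝ} (hκ : 0 ≤ κ) (hκ₀ : 0 ≤ κ₀)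
    (hs : κ + κ₀ < n) {x₀ : EuclideanSpace ℝ (Fin n)} {d : ℝ} (hd : 0 < d) :
    Integrable (fun y => ‖x₀ - y‖ ^ (-κ) * ∫ z in ball x₀ (2 * d), ‖y - z‖ ^ (-κ₀) ∂ν)
      (volume.restrict (ball x₀ d)) ∧
    ∫ y in ball x₀ d, ‖x₀ - y‖ ^ (-κ) * ∫ z in ball x₀ (2 * d), ‖y - z‖ ^ (-κ₀) ∂ν ≤
      ν.real (ball x₀ (2 * d)) *
        (2 * ((∫ z in ball (0 : EuclideanSpace ℝ (Fin n)) 1, ‖z‖ ^ (-(κ + κ₀))) *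
          (3 * d) ^ (n - (κ + κ₀)))) := by
  have : Nontrivial (EuclideanSpace ℝ (Fin n)) := by
    have : Nonempty (Fin n) := ⟨⟨0, by omega⟩⟩
    infer_instance
  set c := (∫ z in ball (0 : EuclideanSpace ℝ (Fin n)) 1, ‖z‖ ^ (-(κ + κ₀))) *
          (3 * d) ^ (n - (κ + κ₀))
  set P := volume.restrict (ball x₀ d)
  set Q := ν.restrict (ball x₀ (2 * d))
  set k := fun p : EuclideanSpace ℝ (Fin n) × EuclideanSpace ℝ (Fin n) =>
    ‖x₀ - p.1‖ ^ (-κ) * ‖p.1 - p.2‖ ^ (-κ₀)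
  have hkm : Measurable k := by fun_prop
  have hk0 : ∀ p, 0 ≤ k p := fun p => by positivity
  have hx₀ : x₀ ∈ ball x₀ (2 * d) := mem_ball_self (by positivity)
  have A := fun z (hz : z ∈ ball x₀ (2 * d)) =>
    setIntegral_ball_norm_sub_rpow_le (n := n) (by omega) hs hd hz
  have hae : ∀ a : EuclideanSpace ℝ (Fin n), ∀ᵐ y ∂P, y ≠ a := fun a => by
    simp [ae_iff]
  have hle : ∀ z, ∀ᵐ y ∂P, k (y, z) ≤ ‖x₀ - y‖ ^ (-(κ + κ₀)) + ‖z - y‖ ^ (-(κ + κ₀)) := by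
    intro z
    filter_upwards [hae z, hae x₀] with y h1 h2
    simp only [k]
    rw [norm_sub_rev y z]
    exact rpow_neg_mul_rpow_neg_le (norm_pos_iff.2 (sub_ne_zero.2 h2.symm))
      (norm_pos_iff.2 (sub_ne_zero.2 h1.symm)) hκ hκ₀
  have hki : ∀ z ∈ ball x₀ (2 * d), Integrable (fun y => k (y, z)) P := fun z hz => by
    refine ((A x₀ hx₀).1.add (A z hz).1).mono'
      (hkm.comp measurable_prodMk_right).aestronglyMeasurable ?_
    filter_upwards [hle z] with y hy
    rw [Real.norm_of_nonneg (hk0 _)]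
    exact hy
  have hkc : ∀ z ∈ ball x₀ (2 * d), ∫ y, k (y, z) ∂P ≤ 2 * c := fun z hz => by
    refine (integral_mono_ae (hki z hz) ((A x₀ hx₀).1.add (A z hz).1) (hle z)).trans ?_
    simp only [Pi.add_apply]
    rw [integral_add (A x₀ hx₀).1 (A z hz).1]
    linarith [(A x₀ hx₀).2, (A z hz).2]
  have hin : Integrable (fun z => ∫ y, k (y, z) ∂P) Q := by
    refine (integrable_const (2 * c)).mono' ?_ ?_
    · exact (hkm.stronglyMeasurable.integral_prod_left).aestronglyMeasurable
    · filter_upwards [ae_restrict_mem measurableSet_ball] with z hz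
      rw [Real.norm_of_nonneg (integral_nonneg fun y => hk0 _)]
      exact hkc z hz
  have hprod : Integrable k (P.prod Q) := by
    rw [integrable_prod_iff' hkm.aestronglyMeasurable]
    refine ⟨?_, ?_⟩
    · filter_upwards [ae_restrict_mem measurableSet_ball] with z hz using hki z hz
    · simpa only [Real.norm_of_nonneg (hk0 _)] using hin
  have e : ∀ y, ‖x₀ - y‖ ^ (-κ) * ∫ z, ‖y - z‖ ^ (-κ₀) ∂Q =
      ∫ z, k (y, z) ∂Q := fun y => by rw [← integral_const_mul]
  simp only [e]
  refine ⟨hprod.integral_prod_left, ?_⟩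
  rw [integral_integral_swap hprod]
  calc ∫ z, ∫ y, k (y, z) ∂P ∂Q ≤ ∫ z, 2 * c ∂Q := by
        refine integral_mono_ae hin (integrable_const _) ?_
        filter_upwards [ae_restrict_mem measurableSet_ball] with z hz using hkc z hz
    _ = _ := by simp [Q]

/-- Where the mass of `ν` is small, the density `exp (γ u)` does not concentrate at the scale `d`. -/
theorem setIntegral_exp_logPot_mul_rpow_le [NullSingletonClass ν] (hn : 2 ≤ n)
    (hI : ∀ x, Integrable (fun y => ‖x - y‖⁻¹) ν) {γ κ κ₀ : ℝ} (hγ : 0 < γ) (hκ : 0 ≤ κ)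
    (hκ₀ : 0 ≤ κ₀) (hs : κ + κ₀ < n) (hIκ : ∀ x, Integrable (fun y => ‖x - y‖ ^ (-κ₀)) ν)
    {u : EuclideanSpace ℝ (Fin n) → ℝ} {C : ℝ} (hu : ∀ x, u x = logPot ν x + C)
    (huc : Continuous u) (hFi : Integrable fun y => Real.exp (γ * u y))
    {x₀ : EuclideanSpace ℝ (Fin n)} {d : ℝ} (hd : 0 < d)
    (hM0 : 0 < ν.real (ball x₀ (2 * d))) (hM : γ * ν.real (ball x₀ (2 * d)) ≤ κ₀) :
    ∫ y in ball x₀ d, Real.exp (γ * u y) * ‖x₀ - y‖ ^ (-κ) ≤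
      (Real.exp (γ * (ν.real Set.univ * Real.log 3)) * (∫ y, Real.exp (γ * u y)) /
        volume.real (ball (0 : EuclideanSpace ℝ (Fin n)) 1) *
        (2 * ∫ z in ball (0 : EuclideanSpace ℝ (Fin n)) 1, ‖z‖ ^ (-(κ + κ₀))) *
        3 ^ (n - κ)) * d ^ (-κ) := by
  set α := ν.real Set.univ
  set I := ∫ y, Real.exp (γ * u y)
  set ω := volume.real (ball (0 : EuclideanSpace ℝ (Fin n)) 1)
  set c := ∫ z in ball (0 : EuclideanSpace ℝ (Fin n)) 1, ‖z‖ ^ (-(κ + κ₀))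
  set M := ν.real (ball x₀ (2 * d))
  set J := fun y => ∫ z in ball x₀ (2 * d), ‖y - z‖ ^ (-κ₀) ∂ν
  have hω : 0 < ω := ENNReal.toReal_pos (measure_ball_pos _ _ one_pos).ne' measure_ball_lt_top.ne
  have hvol : volume.real (ball x₀ d) = d ^ (n : ℝ) * ω := by
    simp only [Measure.real, ω]
    rw [Measure.addHaar_ball_of_pos _ _ hd, ENNReal.toReal_mul, finrank_euclideanSpace_fin,
      ENNReal.toReal_ofReal (by positivity), Real.rpow_natCast]
  have hdn : 0 < d ^ (n : ℝ) := by positivity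
  have key : ∀ y ∈ ball x₀ d, Real.exp (γ * u y) ≤
      (Real.exp (γ * (α * Real.log 3)) * (M⁻¹ * (3 * d) ^ κ₀) * I / (d ^ (n : ℝ) * ω)) * J y := by
    intro y hy
    have h1 : ∀ y' ∈ ball x₀ d, Real.exp (γ * u y) ≤
        Real.exp (γ * (α * Real.log 3)) * (M⁻¹ * ((3 * d) ^ κ₀ * J y)) * Real.exp (γ * u y') := by
      intro y' hy'
      have h2 := logPot_sub_le hI hy hy'
      have h3 := exp_integral_log_le hI hIκ hy hM0 hM
      calc Real.exp (γ * u y) ≤ Real.exp (γ * (α * Real.log 3)) *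
          Real.exp (γ * ∫ z in ball x₀ (2 * d), Real.log (3 * d / ‖y - z‖) ∂ν) *
            Real.exp (γ * u y') := by
            rw [← Real.exp_add, ← Real.exp_add, Real.exp_le_exp, ← mul_add, ← mul_add]
            refine mul_le_mul_of_nonneg_left ?_ hγ.le
            rw [hu y, hu y']
            linarith
        _ ≤ _ := by gcongr
    have hdI : 0 < d ^ (n : ℝ) * ω := by positivity
    have hJ0 : 0 ≤ J y := integral_nonneg fun z => by positivity
    rw [div_mul_eq_mul_div, le_div_iff₀ hdI, ← hvol]
    calc Real.exp (γ * u y) * volume.real (ball x₀ d) = ∫ _ in ball x₀ d, Real.exp (γ * u y) := by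
          simp [mul_comm]
      _ ≤ ∫ y' in ball x₀ d, Real.exp (γ * (α * Real.log 3)) *
            (M⁻¹ * ((3 * d) ^ κ₀ * J y)) * Real.exp (γ * u y') := by
          refine setIntegral_mono_on (integrableOn_const measure_ball_lt_top.ne)
            (hFi.const_mul _).integrableOn measurableSet_ball h1
      _ = Real.exp (γ * (α * Real.log 3)) * (M⁻¹ * ((3 * d) ^ κ₀ * J y)) *
            ∫ y' in ball x₀ d, Real.exp (γ * u y') := by rw [integral_const_mul]
      _ ≤ Real.exp (γ * (α * Real.log 3)) * (M⁻¹ * ((3 * d) ^ κ₀ * J y)) * I := by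
          refine mul_le_mul_of_nonneg_left ?_ (by positivity)
          exact setIntegral_le_integral hFi (ae_of_all _ fun y => (Real.exp_pos _).le)
      _ = _ := by ring
  obtain ⟨hki, hkle⟩ := integral_integral_kernel_le (ν := ν) hn hκ hκ₀ hs (x₀ := x₀) hd
  set D := Real.exp (γ * (α * Real.log 3)) * (M⁻¹ * (3 * d) ^ κ₀) * I / (d ^ (n : ℝ) * ω)
  have hI0 : 0 ≤ I := integral_nonneg fun y => (Real.exp_pos _).le
  have hD : 0 ≤ D := by positivity
  have hpt : ∀ y ∈ ball x₀ d, Real.exp (γ * u y) * ‖x₀ - y‖ ^ (-κ) ≤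
      D * (‖x₀ - y‖ ^ (-κ) * J y) := fun y hy => by
    calc _ ≤ (D * J y) * ‖x₀ - y‖ ^ (-κ) :=
          mul_le_mul_of_nonneg_right (key y hy) (by positivity)
      _ = _ := by ring
  have hm : ∫ y in ball x₀ d, Real.exp (γ * u y) * ‖x₀ - y‖ ^ (-κ) ≤
      ∫ y in ball x₀ d, D * (‖x₀ - y‖ ^ (-κ) * J y) := by
    refine setIntegral_mono_on ?_ (hki.const_mul D) measurableSet_ball hpt
    refine (hki.const_mul D).mono' ?_ ?_
    · have := huc.measurable
      exact Measurable.aestronglyMeasurable (by fun_prop)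
    · filter_upwards [ae_restrict_mem measurableSet_ball] with y hy
      rw [Real.norm_of_nonneg (by positivity)]
      exact hpt y hy
  refine hm.trans ?_
  rw [integral_const_mul]
  refine (mul_le_mul_of_nonneg_left hkle hD).trans_eq ?_
  have e1 : (3 * d) ^ ((n : ℝ) - (κ + κ₀)) * (3 * d) ^ κ₀ = 3 ^ ((n : ℝ) - κ) * (d ^ (n : ℝ) * d ^ (-κ)) := by
    rw [← Real.rpow_add (by positivity), ← Real.rpow_add hd, Real.mul_rpow (by norm_num) hd.le]
    congr 2 <;> ring
  calc D * (M * (2 * (c * (3 * d) ^ ((n : ℝ) - (κ + κ₀)))))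
      = Real.exp (γ * (α * Real.log 3)) * I * (2 * c) * (M⁻¹ * M) *
        ((3 * d) ^ ((n : ℝ) - (κ + κ₀)) * (3 * d) ^ κ₀) / (d ^ (n : ℝ) * ω) := by
        simp only [D]; ring
    _ = _ := by
        rw [e1, inv_mul_cancel₀ hM0.ne']
        field_simp

end Regularity

/-- A positive continuous integrable function on `ℝⁿ` whose Riesz energy of order `μ` is finite,
together with a normalising constant `β`. -/
structure FiniteEnergy (n : ℕ) (μ β : ℝ) (F : EuclideanSpace ℝ (Fin n) → ℝ) : Prop where
  two_le : 2 ≤ n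
  exponent_pos : 0 < μ
  exponent_lt : μ < n
  const_pos : 0 < β
  continuous : Continuous F
  pos : ∀ y, 0 < F y
  integrable : Integrable F
  integrable_energy : Integrable (fun p : EuclideanSpace ℝ (Fin n) × EuclideanSpace ℝ (Fin n) =>
    F p.1 * F p.2 / ‖p.1 - p.2‖ ^ μ)

/-- The density `(F * |·|^{-μ}) F / β`. -/
def energyDensity {n : ℕ} (μ β : ℝ) (F : EuclideanSpace ℝ (Fin n) → ℝ)
    (y : EuclideanSpace ℝ (Fin n)) : ℝ :=
  rieszPot μ F y * F y / β

/-- The measure with density `energyDensity μ β F`. -/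
def energyMeasure {n : ℕ} (μ β : ℝ) (F : EuclideanSpace ℝ (Fin n) → ℝ) :
    Measure (EuclideanSpace ℝ (Fin n)) :=
  volume.withDensity fun y => ENNReal.ofReal (energyDensity μ β F y)

namespace FiniteEnergy

variable {n : ℕ} {μ β : ℝ} {F : EuclideanSpace ℝ (Fin n) → ℝ}

theorem one_le (h : FiniteEnergy n μ β F) : 1 ≤ n := le_trans (by norm_num) h.two_le

theorem one_lt_cast (h : FiniteEnergy n μ β F) : (1 : ℝ) < n := by
  have := h.two_le
  exact_mod_cast (show 1 < n by omega)

theorem rieszPot_pos (h : FiniteEnergy n μ β F) (x : EuclideanSpace ℝ (Fin n)) :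
    0 < rieszPot μ F x := by
  obtain ⟨c, hc, hle⟩ := rieszPot_lower_bound h.one_le h.exponent_pos h.exponent_lt h.continuous
    h.pos h.integrable
  have := norm_nonneg x
  exact lt_of_lt_of_le (by positivity) (hle x)

theorem measurable_rieszPot (h : FiniteEnergy n μ β F) : Measurable (rieszPot μ F) := by
  have := h.continuous.measurable
  have hm : Measurable fun p : EuclideanSpace ℝ (Fin n) × EuclideanSpace ℝ (Fin n) =>
      F p.2 / ‖p.1 - p.2‖ ^ μ := by fun_prop
  exact hm.stronglyMeasurable.integral_prod_right.measurable

theorem measurable_density (h : FiniteEnergy n μ β F) : Measurable (energyDensity μ β F) :=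
  (h.measurable_rieszPot.mul h.continuous.measurable).div_const β

theorem density_pos (h : FiniteEnergy n μ β F) (x : EuclideanSpace ℝ (Fin n)) :
    0 < energyDensity μ β F x :=
  div_pos (mul_pos (h.rieszPot_pos x) (h.pos x)) h.const_pos

theorem integrable_density (h : FiniteEnergy n μ β F) : Integrable (energyDensity μ β F) := by
  refine (h.integrable_energy.integral_prod_left.div_const β).congr (ae_of_all _ fun x => ?_)
  simp only [energyDensity, rieszPot, mul_div_assoc]
  rw [integral_const_mul]
  ring

theorem exists_density_bound_on_balls (h : FiniteEnergy n μ β F) (R : ℝ) :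
    ∃ M, ∀ x : EuclideanSpace ℝ (Fin n), ‖x‖ ≤ R → energyDensity μ β F x ≤ M := by
  obtain ⟨M₁, h₁, hM₁⟩ := exists_bound_on_balls h.continuous R
  obtain ⟨M₂, h₂, hM₂⟩ := exists_rieszPot_bound_on_balls h.one_le h.exponent_pos h.exponent_lt
    h.continuous (fun y => (h.pos y).le) h.integrable R
  refine ⟨M₂ * M₁ / β, fun x hx => ?_⟩
  have := h.const_pos
  have := (h.pos x).le
  unfold energyDensity
  gcongr
  · exact hM₂ x hx
  · exact hM₁ x hx

theorem isFiniteMeasure (h : FiniteEnergy n μ β F) : IsFiniteMeasure (energyMeasure μ β F) :=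
  isFiniteMeasure_withDensity_ofReal h.integrable_density.2

theorem nullSingletonClass (h : FiniteEnergy n μ β F) :
    NullSingletonClass (energyMeasure μ β F) := by
  have : Nonempty (Fin n) := ⟨⟨0, h.one_le⟩⟩
  unfold energyMeasure
  infer_instance

theorem integrable_iff (h : FiniteEnergy n μ β F) {g : EuclideanSpace ℝ (Fin n) → ℝ} :
    Integrable g (energyMeasure μ β F) ↔ Integrable fun y => energyDensity μ β F y * g y := by
  unfold energyMeasure
  rw [integrable_withDensity_iff_integrable_smul' (by exact h.measurable_density.ennreal_ofReal)
    (ae_of_all _ fun x => ENNReal.ofReal_lt_top)]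
  simp only [ENNReal.toReal_ofReal (h.density_pos _).le, smul_eq_mul]

theorem integral_eq (h : FiniteEnergy n μ β F) (g : EuclideanSpace ℝ (Fin n) → ℝ) :
    ∫ y, g y ∂(energyMeasure μ β F) = ∫ y, energyDensity μ β F y * g y := by
  have e : energyMeasure μ β F =
      volume.withDensity fun y => ((energyDensity μ β F y).toNNReal : ENNReal) := rfl
  rw [e, integral_withDensity_eq_integral_smul h.measurable_density.real_toNNReal]
  refine integral_congr_ae (ae_of_all _ fun y => ?_)
  simp [NNReal.smul_def, (h.density_pos y).le]

theorem measureReal_ball_pos (h : FiniteEnergy n μ β F) (x : EuclideanSpace ℝ (Fin n)) {r : ℝ}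
    (hr : 0 < r) : 0 < (energyMeasure μ β F).real (ball x r) := by
  have := h.isFiniteMeasure
  refine ENNReal.toReal_pos (fun h0 => ?_) (measure_ne_top _ _)
  have hac : (volume : Measure (EuclideanSpace ℝ (Fin n))) ≪ energyMeasure μ β F :=
    withDensity_absolutelyContinuous' h.measurable_density.ennreal_ofReal.aemeasurable
      (ae_of_all _ fun x => by simpa using h.density_pos x)
  exact (measure_ball_pos volume x hr).ne' (hac h0)

theorem integrable_density_mul_rpow (h : FiniteEnergy n μ β F) {κ : ℝ} (hκ0 : 0 ≤ κ) (hκ : κ < n)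
    (x : EuclideanSpace ℝ (Fin n)) :
    Integrable (fun y => energyDensity μ β F y * ‖x - y‖ ^ (-κ)) := by
  obtain ⟨M, hM⟩ := h.exists_density_bound_on_balls (‖x‖ + 1)
  refine (integrable_mul_norm_sub_rpow h.one_le hκ0 hκ h.integrable_density
    (fun y => (h.density_pos y).le) one_pos (M := M) fun y hy => hM y ?_).1
  rw [mem_ball, dist_eq_norm] at hy
  linarith [norm_sub_norm_le y x]

theorem integrable_rpow (h : FiniteEnergy n μ β F) {κ : ℝ} (hκ0 : 0 ≤ κ) (hκ : κ < n)
    (x : EuclideanSpace ℝ (Fin n)) :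
    Integrable (fun y => ‖x - y‖ ^ (-κ)) (energyMeasure μ β F) :=
  h.integrable_iff.2 (h.integrable_density_mul_rpow hκ0 hκ x)

theorem integrable_inv (h : FiniteEnergy n μ β F) (x : EuclideanSpace ℝ (Fin n)) :
    Integrable (fun y => ‖x - y‖⁻¹) (energyMeasure μ β F) := by
  simpa only [Real.rpow_neg_one] using h.integrable_rpow zero_le_one h.one_lt_cast x

end FiniteEnergy

theorem integral_mul_rpow_le_add {n : ℕ} {G : EuclideanSpace ℝ (Fin n) → ℝ} (hG : Integrable G)
    (hG0 : ∀ y, 0 ≤ G y) {κ : ℝ} (hκ : 0 ≤ κ) {x : EuclideanSpace ℝ (Fin n)}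
    (hi : Integrable fun y => G y * ‖x - y‖ ^ (-κ)) {d : ℝ} (hd : 0 < d) :
    ∫ y, G y * ‖x - y‖ ^ (-κ) ≤
      (∫ y in ball x d, G y * ‖x - y‖ ^ (-κ)) + d ^ (-κ) * ∫ y, G y := by
  rw [← integral_add_compl measurableSet_ball hi]
  gcongr
  rw [← integral_const_mul]
  refine (setIntegral_mono_on hi.integrableOn (hG.const_mul (d ^ (-κ))).integrableOn
    measurableSet_ball.compl fun y hy => ?_).trans
    (setIntegral_le_integral (hG.const_mul _) (ae_of_all _ fun y => ?_))
  · rw [mul_comm]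
    refine mul_le_mul_of_nonneg_right ?_ (hG0 y)
    rw [Set.mem_compl_iff, mem_ball', dist_eq_norm, not_lt] at hy
    exact Real.rpow_le_rpow_of_nonpos hd hy (by linarith)
  · have := hG0 y
    simp only [Pi.zero_apply]
    positivity

namespace FiniteEnergy

variable {n : ℕ} {μ β γ C : ℝ} {u : EuclideanSpace ℝ (Fin n) → ℝ}

theorem exists_setIntegral_ball_le (h : FiniteEnergy n μ β fun y => Real.exp (γ * u y))
    (hγ : 0 < γ) (huc : Continuous u)
    (hu : ∀ x, u x = logPot (energyMeasure μ β fun y => Real.exp (γ * u y)) x + C)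
    {κ : ℝ} (hκ0 : 0 ≤ κ) (hκ : κ < n) :
    ∃ R D, 0 < R ∧ ∀ x : EuclideanSpace ℝ (Fin n), R ≤ ‖x‖ →
      ∫ y in ball x (‖x‖ / 4), Real.exp (γ * u y) * ‖x - y‖ ^ (-κ) ≤ D * (‖x‖ / 4) ^ (-κ) := by
  have := h.isFiniteMeasure
  have := h.nullSingletonClass
  set ν := energyMeasure μ β fun y => Real.exp (γ * u y)
  have hκ₀ : 0 < (n - κ) / 2 := by linarith
  have ht := tendsto_measure_compl_closedBall_of_isTightMeasureSet
    (isTightMeasureSet_singleton (μ := ν)) 0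
  simp only [Set.mem_singleton_iff, iSup_iSup_eq_left] at ht
  have hev := ht.eventually (gt_mem_nhds
    (show (0 : ENNReal) < ENNReal.ofReal ((n - κ) / 2 / γ) by
      rw [ENNReal.ofReal_pos]; positivity))
  obtain ⟨r, hr, hr0⟩ := (hev.and (eventually_gt_atTop 0)).exists
  have hM : ∀ x : EuclideanSpace ℝ (Fin n), 2 * r ≤ ‖x‖ →
      γ * ν.real (ball x (2 * (‖x‖ / 4))) ≤ (n - κ) / 2 := by
    intro x hx
    have hsub : ball x (2 * (‖x‖ / 4)) ⊆ (closedBall 0 r)ᶜ := by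
      intro y hy
      rw [Set.mem_compl_iff, mem_closedBall_zero_iff, not_le]
      rw [mem_ball, dist_eq_norm] at hy
      have := norm_sub_norm_le x y
      rw [norm_sub_rev] at this
      linarith
    have h1 : ν.real (ball x (2 * (‖x‖ / 4))) ≤ (n - κ) / 2 / γ :=
      ENNReal.toReal_le_of_le_ofReal (by positivity) ((measure_mono hsub).trans hr.le)
    rw [le_div_iff₀ hγ] at h1
    linarith
  have hd : ∀ x : EuclideanSpace ℝ (Fin n), 2 * r ≤ ‖x‖ → 0 < ‖x‖ / 4 := fun x hx => by linarith
  have key := fun x hx => setIntegral_exp_logPot_mul_rpow_le h.two_le h.integrable_inv hγ hκ0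
    hκ₀.le (by linarith) (fun x => h.integrable_rpow hκ₀.le (by linarith) x) hu huc h.integrable
    (hd x hx) (h.measureReal_ball_pos x (mul_pos two_pos (hd x hx))) (hM x hx)
  exact ⟨2 * r, _, by positivity, key⟩

theorem exists_rieszPot_le (h : FiniteEnergy n μ β fun y => Real.exp (γ * u y))
    (hγ : 0 < γ) (huc : Continuous u)
    (hu : ∀ x, u x = logPot (energyMeasure μ β fun y => Real.exp (γ * u y)) x + C) :
    ∃ B, ∀ x, rieszPot μ (fun y => Real.exp (γ * u y)) x ≤ B := by
  obtain ⟨R, D, hR, hD⟩ := h.exists_setIntegral_ball_le hγ huc hu h.exponent_pos.le h.exponent_lt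
  obtain ⟨M, hM0, hM⟩ := exists_rieszPot_bound_on_balls h.one_le h.exponent_pos h.exponent_lt
    h.continuous (fun y => (h.pos y).le) h.integrable R
  set I := ∫ y, Real.exp (γ * u y)
  have hI0 : 0 ≤ I := integral_nonneg fun y => (Real.exp_pos _).le
  refine ⟨max M ((|D| + I) * (R / 4) ^ (-μ)), fun x => ?_⟩
  rcases le_total ‖x‖ R with hx | hx
  · exact (hM x hx).trans (le_max_left _ _)
  refine le_trans ?_ (le_max_right _ _)
  have hi := integrable_rieszPot h.one_le h.exponent_pos h.exponent_lt
    h.continuous (fun y => (h.pos y).le) h.integrable x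
  have hd : 0 < ‖x‖ / 4 := by linarith
  rw [rieszPot_eq]
  have h1 := integral_mul_rpow_le_add h.integrable (fun y => (h.pos y).le) h.exponent_pos.le hi hd
  have h2 := hD x hx
  have h3 : (‖x‖ / 4) ^ (-μ) ≤ (R / 4) ^ (-μ) :=
    Real.rpow_le_rpow_of_nonpos (by positivity) (by linarith) (by linarith [h.exponent_pos])
  calc _ ≤ (D + I) * (‖x‖ / 4) ^ (-μ) := by linarith
    _ ≤ (|D| + I) * (‖x‖ / 4) ^ (-μ) := by gcongr; exact le_abs_self D
    _ ≤ _ := by gcongr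

theorem exists_norm_mul_integral_inv_le (h : FiniteEnergy n μ β fun y => Real.exp (γ * u y))
    (hγ : 0 < γ) (huc : Continuous u)
    (hu : ∀ x, u x = logPot (energyMeasure μ β fun y => Real.exp (γ * u y)) x + C) :
    ∃ K, ∀ x : EuclideanSpace ℝ (Fin n),
      ∫ y, ‖x‖ * ‖x - y‖⁻¹ ∂(energyMeasure μ β fun y => Real.exp (γ * u y)) ≤ K := by
  obtain ⟨B, hB⟩ := h.exists_rieszPot_le hγ huc hu
  obtain ⟨R, D, hR, hD⟩ := h.exists_setIntegral_ball_le hγ huc hu zero_le_one h.one_lt_cast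
  obtain ⟨M, hM⟩ := h.exists_density_bound_on_balls (R + 1)
  set F := fun y => Real.exp (γ * u y)
  set ρ := energyDensity μ β F
  have hρ0 : ∀ y, 0 ≤ ρ y := fun y => (h.density_pos y).le
  have hB0 : 0 ≤ B := (h.rieszPot_pos 0).le.trans (hB 0)
  have hβ := h.const_pos
  have hρF : ∀ y, ρ y ≤ B / β * F y := fun y => by
    have := (h.pos y).le
    have := hB y
    simp only [ρ, energyDensity]
    rw [mul_div_right_comm]
    gcongr
  have hM0 : 0 ≤ M := (hρ0 0).trans (hM 0 (by simp; linarith))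
  set c := ∫ z in ball (0 : EuclideanSpace ℝ (Fin n)) 1, ‖z‖ ^ (-1 : ℝ)
  have hc0 : 0 ≤ c := integral_nonneg fun z => by positivity
  set α := ∫ y, ρ y
  have hα0 : 0 ≤ α := integral_nonneg hρ0
  refine ⟨max (R * (M * (c * 1 ^ ((n : ℝ) - 1)) + 1 ^ (-1 : ℝ) * α))
    (4 * (B / β * D + α)), fun x => ?_⟩
  have e : ∫ y, ‖x‖ * ‖x - y‖⁻¹ ∂(energyMeasure μ β F) =
      ‖x‖ * ∫ y, ρ y * ‖x - y‖ ^ (-1 : ℝ) := by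
    rw [integral_const_mul, h.integral_eq]
    simp only [Real.rpow_neg_one, ρ]
  rw [e]
  have hi := h.integrable_density_mul_rpow zero_le_one h.one_lt_cast x
  rcases le_total ‖x‖ R with hx | hx
  · refine le_trans ?_ (le_max_left _ _)
    refine mul_le_mul hx ?_ (integral_nonneg fun y => ?_) hR.le
    · refine (integrable_mul_norm_sub_rpow h.one_le zero_le_one h.one_lt_cast h.integrable_density
        hρ0 one_pos (M := M) fun y hy => hM y ?_).2
      rw [mem_ball, dist_eq_norm] at hy
      linarith [norm_sub_norm_le y x]
    · have := hρ0 y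
      simp only [Pi.zero_apply]
      positivity
  · refine le_trans ?_ (le_max_right _ _)
    have hx0 : 0 < ‖x‖ := by linarith
    have hd : 0 < ‖x‖ / 4 := by linarith
    have h1 := integral_mul_rpow_le_add h.integrable_density hρ0 zero_le_one hi hd
    have h2 := hD x hx
    have hFi := (integrable_mul_norm_sub_rpow (x := x) (r := ‖x‖ / 4) h.one_le zero_le_one
      h.one_lt_cast h.integrable (fun y => (h.pos y).le) hd
      (M := (exists_bound_on_balls h.continuous (2 * ‖x‖)).choose) fun y hy =>
        (exists_bound_on_balls h.continuous (2 * ‖x‖)).choose_spec.2 y (by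
          rw [mem_ball, dist_eq_norm] at hy
          linarith [norm_sub_norm_le y x])).1
    have h3 : ∫ y in ball x (‖x‖ / 4), ρ y * ‖x - y‖ ^ (-1 : ℝ) ≤
        B / β * ∫ y in ball x (‖x‖ / 4), F y * ‖x - y‖ ^ (-1 : ℝ) := by
      rw [← integral_const_mul]
      refine integral_mono hi.integrableOn (hFi.const_mul _).integrableOn fun y => ?_
      simp only
      rw [← mul_assoc]
      exact mul_le_mul_of_nonneg_right (hρF y) (by positivity)
    have h4 : B / β * ∫ y in ball x (‖x‖ / 4), F y * ‖x - y‖ ^ (-1 : ℝ) ≤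
        B / β * (D * (‖x‖ / 4) ^ (-1 : ℝ)) := mul_le_mul_of_nonneg_left h2 (by positivity)
    calc ‖x‖ * ∫ y, ρ y * ‖x - y‖ ^ (-1 : ℝ)
        ≤ ‖x‖ * (B / β * (D * (‖x‖ / 4) ^ (-1 : ℝ)) + (‖x‖ / 4) ^ (-1 : ℝ) * α) :=
          mul_le_mul_of_nonneg_left (by linarith) hx0.le
      _ = _ := by
          rw [Real.rpow_neg_one]
          field_simp

end FiniteEnergy

namespace FiniteEnergy

variable {n : ℕ} {μ β γ C : ℝ} {u : EuclideanSpace ℝ (Fin n) → ℝ}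

/-- Invariance of the Riesz energy under the conformal dilations `u ↦ u(t·) + log t`, linearised
through `1 + s ≤ exp s`. -/
theorem integral_dilation_nonpos (h : FiniteEnergy n μ β fun y => Real.exp (γ * u y))
    (hγ : 2 * γ + μ = 2 * n) (hγ0 : 0 < γ) (huc : Continuous u) {t : ℝ} (ht : 0 < t) {B : ℝ}
    (hB : ∀ x, |u (t • x) - u x + Real.log t| ≤ B) :
    ∫ x, (u (t • x) - u x + Real.log t) ∂(energyMeasure μ β fun y => Real.exp (γ * u y)) ≤ 0 := by
  have hH : (volume : Measure (EuclideanSpace ℝ (Fin n) × EuclideanSpace ℝ (Fin n))).IsAddHaarMeasure :=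
    inferInstanceAs (Measure.prod volume volume).IsAddHaarMeasure
  set φ := fun x => u (t • x) - u x + Real.log t with hφ
  have hφc : Continuous φ := by fun_prop
  set W := fun p : EuclideanSpace ℝ (Fin n) × EuclideanSpace ℝ (Fin n) =>
    Real.exp (γ * u p.1) * Real.exp (γ * u p.2) / ‖p.1 - p.2‖ ^ μ with hW
  have hWi : Integrable W := h.integrable_energy
  have hW0 : ∀ p, 0 ≤ W p := fun p => by positivity
  have hsc : ∀ p, t ^ (2 * n) * W (t • p) = W p * Real.exp (γ * (φ p.1 + φ p.2)) := by
    intro p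
    have e1 : ‖t • p.1 - t • p.2‖ ^ μ = t ^ μ * ‖p.1 - p.2‖ ^ μ := by
      rw [← smul_sub, norm_smul, Real.norm_of_nonneg ht.le,
        Real.mul_rpow ht.le (norm_nonneg _)]
    have e2 : t ^ (2 * n) = t ^ μ * Real.exp (2 * γ * Real.log t) := by
      rw [← Real.rpow_natCast, mul_comm (2 * γ), ← Real.rpow_def_of_pos ht, ← Real.rpow_add ht]
      congr 1
      push_cast
      linarith
    have e3 : Real.exp (γ * (φ p.1 + φ p.2)) * (Real.exp (γ * u p.1) * Real.exp (γ * u p.2)) =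
        Real.exp (2 * γ * Real.log t) * (Real.exp (γ * u (t • p.1)) * Real.exp (γ * u (t • p.2))) := by
      rw [← Real.exp_add, ← Real.exp_add, ← Real.exp_add, ← Real.exp_add]
      congr 1
      simp only [hφ]
      ring
    have ht' : t ^ μ ≠ 0 := (Real.rpow_pos_of_pos ht μ).ne'
    simp only [hW, Prod.smul_fst, Prod.smul_snd, e1]
    rw [div_mul_eq_mul_div, mul_comm (_ * _) (Real.exp (γ * (φ p.1 + φ p.2))), e3, e2]
    rw [mul_assoc (t ^ μ), ← mul_div_assoc (Real.exp (2 * γ * Real.log t)),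
      ← mul_div_assoc (t ^ μ), mul_div_mul_left _ _ ht']
  have hWt : Integrable fun p => W p * Real.exp (γ * (φ p.1 + φ p.2)) := by
    simp only [← hsc]
    exact (((integrable_comp_smul_iff volume W ht.ne').2 hWi)).const_mul _
  have hinv : ∫ p, W p * Real.exp (γ * (φ p.1 + φ p.2)) = ∫ p, W p := by
    simp only [← hsc]
    rw [integral_const_mul, Measure.integral_comp_smul, Module.finrank_prod,
      finrank_euclideanSpace_fin, ← two_mul, abs_of_pos (by positivity), smul_eq_mul,
      mul_inv_cancel_left₀ (by positivity)]
  have hWφ : ∀ f : EuclideanSpace ℝ (Fin n) × EuclideanSpace ℝ (Fin n) → EuclideanSpace ℝ (Fin n),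
      Continuous f → Integrable fun p => W p * φ (f p) := fun f hf => by
    refine (hWi.mul_const B).mono' (hWi.aestronglyMeasurable.mul
      (hφc.comp hf).aestronglyMeasurable) (ae_of_all _ fun p => ?_)
    rw [norm_mul, Real.norm_of_nonneg (hW0 p)]
    exact mul_le_mul_of_nonneg_left (hB _) (hW0 p)
  have h₁ := hWφ _ continuous_fst
  have h₂ := hWφ _ continuous_snd
  have hlin : ∫ p, (W p + γ * (W p * φ p.1 + W p * φ p.2)) ≤
      ∫ p, W p * Real.exp (γ * (φ p.1 + φ p.2)) := by
    refine integral_mono (hWi.add ((h₁.add h₂).const_mul γ)) hWt fun p => ?_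
    have := mul_le_mul_of_nonneg_left (Real.add_one_le_exp (γ * (φ p.1 + φ p.2))) (hW0 p)
    simp only
    linarith
  have h₁₂ : Integrable fun p => γ * (W p * φ p.1 + W p * φ p.2) := (h₁.add h₂).const_mul γ
  rw [hinv, integral_add hWi h₁₂, integral_const_mul, integral_add h₁ h₂] at hlin
  have hsymm : ∫ p, W p * φ p.2 = ∫ p, W p * φ p.1 := by
    have := integral_prod_swap (μ := (volume : Measure (EuclideanSpace ℝ (Fin n))))
      (ν := (volume : Measure (EuclideanSpace ℝ (Fin n)))) fun p => W p * φ p.1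
    rw [Measure.volume_eq_prod, ← this]
    refine integral_congr_ae (ae_of_all _ fun p => ?_)
    simp only [hW, Prod.fst_swap, Prod.snd_swap, norm_sub_rev p.2 p.1,
      mul_comm (Real.exp (γ * u p.2))]
  have hfst : ∫ p, W p * φ p.1 =
      β * ∫ x, φ x ∂(energyMeasure μ β fun y => Real.exp (γ * u y)) := by
    rw [h.integral_eq, Measure.volume_eq_prod, integral_prod _ h₁, ← integral_const_mul]
    refine integral_congr_ae (ae_of_all _ fun x => ?_)
    have := h.const_pos.ne'
    simp only [hW, energyDensity, rieszPot]
    rw [integral_mul_const]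
    simp only [mul_div_assoc]
    rw [integral_const_mul]
    field_simp
  rw [hsymm, hfst] at hlin
  have hβγ : 0 < γ * (β + β) := mul_pos hγ0 (add_pos h.const_pos h.const_pos)
  by_contra! hcon
  have := mul_pos hβγ hcon
  linarith

/-- Solutions of the integral equation have total mass at most two. -/
theorem mass_le_two (h : FiniteEnergy n μ β fun y => Real.exp (γ * u y))
    (hγ : 2 * γ + μ = 2 * n) (huc : Continuous u)
    (hu : ∀ x, u x = logPot (energyMeasure μ β fun y => Real.exp (γ * u y)) x + C) :
    (energyMeasure μ β fun y => Real.exp (γ * u y)).real Set.univ ≤ 2 := by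
  have hγ0 : 0 < γ := by linarith [h.exponent_lt]
  have := h.isFiniteMeasure
  have := h.nullSingletonClass
  obtain ⟨K, hK⟩ := h.exists_norm_mul_integral_inv_le hγ0 huc hu
  refine mass_le_two_of_dilation h.integrable_inv hK fun t ht => ?_
  have e : ∀ x, logPot (energyMeasure μ β fun y => Real.exp (γ * u y)) (t • x) -
      logPot (energyMeasure μ β fun y => Real.exp (γ * u y)) x + Real.log t =
      u (t • x) - u x + Real.log t := fun x => by
    rw [hu (t • x), hu x]
    ring
  simp only [e]
  refine h.integral_dilation_nonpos hγ hγ0 huc ht.1 (B := t⁻¹ * K + |Real.log t|) fun x => ?_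
  rw [← e]
  refine (abs_add_le _ _).trans ?_
  gcongr
  exact abs_logPot_smul_sub_le h.integrable_inv hK ht.1 ht.2.le x

end FiniteEnergy

section RadialMonotonicity

variable {E : Type*} [NormedAddCommGroup E] [NormedSpace ℝ E]

theorem sub_div_le_log_sub_log {r R : ℝ} (hr : 0 < r) (hR : 0 < R) :
    (R - r) / R ≤ Real.log R - Real.log r := by
  have := Real.log_le_sub_one_of_pos (div_pos hr hR)
  rw [Real.log_div hr.ne' hR.ne'] at this
  rw [sub_div, div_self hR.ne']
  linarith

/-- If `f` is Lipschitz near `b` and does not decay faster than `-2p log |x|`, then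
`p log r + f (b + rθ)` increases between the points `r < R` whenever `rR` is small. -/
theorem exists_radial_le {f : E → ℝ} {b : E} {p L C : ℝ} (hp : 0 < p) (hL0 : 0 ≤ L)
    (hL : ∀ y ∈ ball b 1, ∀ y' ∈ ball b 1, |f y - f y'| ≤ L * ‖y - y'‖)
    (hf : ∀ x, -(2 * p * Real.log (1 + ‖x‖)) - C ≤ f x) :
    ∃ σ > 0, ∀ θ : E, ‖θ‖ = 1 → ∀ r R : ℝ, 0 < r → r < R → r * R ≤ σ →
      p * Real.log r + f (b + r • θ) ≤ p * Real.log R + f (b + R • θ) := by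
  set δ := min (1 / 2) (p / (L + 1))
  have hδ0 : 0 < δ := by positivity
  have hδ1 : δ ≤ 1 / 2 := min_le_left _ _
  have hδp : δ ≤ p / (L + 1) := min_le_right _ _
  rw [le_div_iff₀ (by positivity)] at hδp
  set D := (1 + ‖b‖) / δ + 1
  have hD0 : 0 < D := by positivity
  refine ⟨min (δ / 2) (Real.exp (-(2 * p * Real.log D + C + f b + L) / p)),
    by positivity, fun θ hθ r R hr hrR hσ => ?_⟩
  have hR : 0 < R := hr.trans hrR
  have hmem : ∀ s : ℝ, 0 ≤ s → s ≤ 1 / 2 → b + s • θ ∈ ball b 1 := fun s hs hs' => by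
    rw [mem_ball, dist_eq_norm, add_sub_cancel_left, norm_smul, hθ, Real.norm_of_nonneg hs]
    linarith
  rcases le_total R δ with hRδ | hRδ
  · have h1 := hL _ (hmem r hr.le (by linarith)) _ (hmem R hR.le (by linarith))
    rw [add_sub_add_left_eq_sub, ← sub_smul, norm_smul, hθ, mul_one, Real.norm_eq_abs,
      abs_sub_comm r R, abs_of_pos (sub_pos.2 hrR)] at h1
    have h2 := sub_div_le_log_sub_log hr hR
    have h3 : L * (R - r) ≤ p * ((R - r) / R) := by
      rw [← mul_div_assoc, le_div_iff₀ hR]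
      have : L * R ≤ p := by nlinarith
      nlinarith
    have h4 := mul_le_mul_of_nonneg_left h2 hp.le
    linarith [le_abs_self (f (b + r • θ) - f (b + R • θ))]
  · have hσ1 := hσ.trans (min_le_left _ _)
    have hσ2 := hσ.trans (min_le_right _ _)
    have hrle : r ≤ 1 / 2 := by nlinarith
    have h1 := hL _ (hmem r hr.le hrle) b (mem_ball_self one_pos)
    rw [add_sub_cancel_left, norm_smul, hθ, mul_one, Real.norm_of_nonneg hr.le] at h1
    have h2 : f (b + r • θ) ≤ f b + L := by
      have := mul_le_mul_of_nonneg_left (hrle.trans (by norm_num : (1 : ℝ) / 2 ≤ 1)) hL0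
      linarith [le_abs_self (f (b + r • θ) - f b)]
    have h3 := hf (b + R • θ)
    have h4 : Real.log (1 + ‖b + R • θ‖) ≤ Real.log R + Real.log D := by
      rw [← Real.log_mul hR.ne' hD0.ne']
      refine Real.log_le_log (by positivity) ?_
      have h5 := norm_add_le b (R • θ)
      rw [norm_smul, hθ, mul_one, Real.norm_of_nonneg hR.le] at h5
      have h6 : 1 + ‖b‖ ≤ R * ((1 + ‖b‖) / δ) := by
        rw [mul_div_assoc', le_div_iff₀ hδ0, mul_comm]
        gcongr
      simp only [D]
      linarith
    have h7 := Real.log_le_log (mul_pos hr hR) hσ2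
    rw [Real.log_exp, Real.log_mul hr.ne' hR.ne', le_div_iff₀ hp] at h7
    have h8 := mul_le_mul_of_nonneg_left h4 (show 0 ≤ 2 * p by positivity)
    linarith

theorem exists_lipschitz_on_ball {f : E → ℝ} [ProperSpace E] (hf : ContDiff ℝ 1 f) (b : E) (r : ℝ) :
    ∃ L, 0 ≤ L ∧ ∀ y ∈ ball b r, ∀ y' ∈ ball b r, |f y - f y'| ≤ L * ‖y - y'‖ := by
  obtain ⟨L, hL⟩ := (isCompact_closedBall b r).exists_bound_of_continuousOn
    (hf.continuous_fderiv (by norm_num)).continuousOn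
  refine ⟨max L 0, le_max_right _ _, fun y hy y' hy' => ?_⟩
  rw [← Real.norm_eq_abs]
  exact (convex_ball b r).norm_image_sub_le_of_norm_fderiv_le
    (fun x _ => (hf.differentiable (by norm_num)).differentiableAt)
    (fun x hx => (hL x (ball_subset_closedBall hx)).trans (le_max_left _ _)) hy' hy

theorem abs_log_sub_log_le {m a A : ℝ} (hm : 0 < m) (ha : m ≤ a) (hA : m ≤ A) :
    |Real.log a - Real.log A| ≤ m⁻¹ * |a - A| := by
  have key : ∀ {a A : ℝ}, m ≤ a → m ≤ A → Real.log a - Real.log A ≤ m⁻¹ * |a - A| := by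
    intro a A ha hA
    have ha0 : 0 < a := hm.trans_le ha
    have hA0 : 0 < A := hm.trans_le hA
    have h := sub_div_le_log_sub_log hA0 ha0
    have h1 := Real.log_le_sub_one_of_pos (div_pos ha0 hA0)
    rw [Real.log_div ha0.ne' hA0.ne'] at h1
    have h2 : a / A - 1 = A⁻¹ * (a - A) := by field_simp
    rw [h2] at h1
    refine h1.trans ?_
    calc A⁻¹ * (a - A) ≤ A⁻¹ * |a - A| := by gcongr; exact le_abs_self _
      _ ≤ m⁻¹ * |a - A| := by gcongr
  rw [abs_le]
  have h1 := key ha hA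
  have h2 := key hA ha
  rw [abs_sub_comm] at h2
  exact ⟨by linarith, h1⟩

end RadialMonotonicity

section MovingSpheres

variable {n : ℕ}

theorem wMS_nonneg_iff {u : EuclideanSpace ℝ (Fin n) → ℝ} {b θ : EuclideanSpace ℝ (Fin n)}
    (hθ : ‖θ‖ = 1) {r R l : ℝ} (hr : 0 < r) (hR : 0 < R) (h : r * R = (l ^ 2)⁻¹) :
    0 ≤ wMS n u b l (R⁻¹ • θ) ↔
      Real.log r + u (b + r • θ) ≤ Real.log R + u (b + R • θ) := by
  have e1 : ‖R⁻¹ • θ‖ = R⁻¹ := by rw [norm_smul, hθ, mul_one, Real.norm_of_nonneg (by positivity)]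
  have e2 : ((R⁻¹) ^ 2)⁻¹ * R⁻¹ = R := by field_simp
  have e3 : (l ^ 2)⁻¹ * R⁻¹ = r := by rw [← h]; field_simp
  have e4 : Real.log r + Real.log R = -(2 * Real.log l) := by
    rw [← Real.log_mul hr.ne' hR.ne', h, Real.log_inv, Real.log_pow]
    norm_num
  rw [wMS, e1, smul_smul, smul_smul, e2, e3, Real.log_inv]
  constructor <;> intro <;> linarith

theorem zMS_nonneg_iff {μ : ℝ} {u : EuclideanSpace ℝ (Fin n) → ℝ} {b θ : EuclideanSpace ℝ (Fin n)}
    (hV : ∀ x, 0 < V n μ u x)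
    (hθ : ‖θ‖ = 1) {r R l : ℝ} (hr : 0 < r) (hR : 0 < R) (hl : 0 < l) (h : r * R = (l ^ 2)⁻¹) :
    0 ≤ zMS n μ u b l (R⁻¹ • θ) ↔
      μ / 2 * Real.log r + Real.log (V n μ u (b + r • θ)) ≤
        μ / 2 * Real.log R + Real.log (V n μ u (b + R • θ)) := by
  have e1 : ‖R⁻¹ • θ‖ = R⁻¹ := by rw [norm_smul, hθ, mul_one, Real.norm_of_nonneg (by positivity)]
  have e2 : ((R⁻¹) ^ 2)⁻¹ * R⁻¹ = R := by field_simp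
  have e3 : (l ^ 2)⁻¹ * R⁻¹ = r := by rw [← h]; field_simp
  have e4 : Real.log r + Real.log R = -(2 * Real.log l) := by
    rw [← Real.log_mul hr.ne' hR.ne', h, Real.log_inv, Real.log_pow]
    norm_num
  have e5 : μ / 2 * Real.log r + μ / 2 * Real.log R = -(μ * Real.log l) := by
    rw [← mul_add, e4]; ring
  have p1 := Real.rpow_pos_of_pos hl (-μ)
  have p2 := Real.rpow_pos_of_pos (inv_pos.2 hR) (-μ)
  rw [zMS, e1, smul_smul, smul_smul, e2, e3, sub_nonneg,
    ← Real.log_le_log_iff (mul_pos p1 (hV _)) (mul_pos p2 (hV _)),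
    Real.log_mul p1.ne' (hV _).ne', Real.log_mul p2.ne' (hV _).ne', Real.log_rpow hl,
    Real.log_rpow (inv_pos.2 hR), Real.log_inv]
  constructor <;> intro <;> linarith

theorem not_integrable_of_radial_le {u : EuclideanSpace ℝ (Fin n) → ℝ}
    (huc : Continuous u) {γ : ℝ} (hγ0 : 0 < γ) (hγ : γ < n) (b : EuclideanSpace ℝ (Fin n))
    (h : ∀ θ : EuclideanSpace ℝ (Fin n), ‖θ‖ = 1 → ∀ r R : ℝ, 0 < r → r < R →
      Real.log r + u (b + r • θ) ≤ Real.log R + u (b + R • θ)) :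
    ¬ Integrable fun y => Real.exp (γ * u y) := by
  intro hi
  obtain ⟨M, hM⟩ := (isCompact_closedBall b 1).exists_bound_of_continuousOn huc.continuousOn
  have hlow : ∀ x, 1 < ‖x - b‖ → -M - Real.log ‖x - b‖ ≤ u x := by
    intro x hx
    have hx0 : 0 < ‖x - b‖ := by linarith
    have hθ : ‖(‖x - b‖⁻¹ • (x - b))‖ = 1 := by
      rw [norm_smul, norm_inv, norm_norm, inv_mul_cancel₀ hx0.ne']
    have h1 := h _ hθ 1 ‖x - b‖ one_pos hx
    rw [one_smul, smul_smul, mul_inv_cancel₀ hx0.ne', one_smul, add_sub_cancel, Real.log_one] at h1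
    have h2 := hM (b + ‖x - b‖⁻¹ • (x - b)) (by
      rw [mem_closedBall, dist_eq_norm, add_sub_cancel_left, hθ])
    rw [Real.norm_eq_abs] at h2
    linarith [(abs_le.1 h2).1]
  set I := ∫ y, Real.exp (γ * u y)
  set ω := volume.real (ball (0 : EuclideanSpace ℝ (Fin n)) 1)
  have hω : 0 < ω := ENNReal.toReal_pos (measure_ball_pos _ _ one_pos).ne' measure_ball_lt_top.ne
  have hvol : ∀ r : ℝ, 0 ≤ r → volume.real (closedBall b r) = r ^ (n : ℝ) * ω := fun r hr => by
    simp only [Measure.real, ω]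
    rw [Measure.addHaar_closedBall _ _ hr, ENNReal.toReal_mul, finrank_euclideanSpace_fin,
      ENNReal.toReal_ofReal (by positivity), Real.rpow_natCast]
  set c := Real.exp (-(γ * M))
  have hc : 0 < c := Real.exp_pos _
  have hbound : ∀ R : ℝ, 1 ≤ R → R ^ (n - γ) ≤ I / (c * ω) + 1 := by
    intro R hR
    have hR0 : 0 < R := by linarith
    have hsub : closedBall b 1 ⊆ closedBall b R := closedBall_subset_closedBall hR
    have hv : volume.real (closedBall b R \ closedBall b 1) = (R ^ (n : ℝ) - 1) * ω := by
      rw [measureReal_sdiff hsub measurableSet_closedBall measure_closedBall_lt_top.ne, hvol R hR0.le, hvol 1 zero_le_one]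
      simp [sub_mul]
    have h1 : ∫ _ in closedBall b R \ closedBall b 1, c * R ^ (-γ) ≤ I := by
      refine (setIntegral_mono_on (g := fun y => Real.exp (γ * u y)) (integrableOn_const ?_)
        hi.integrableOn (measurableSet_closedBall.diff measurableSet_closedBall)
        fun x hx => ?_).trans
        (setIntegral_le_integral hi (ae_of_all _ fun y => (Real.exp_pos _).le))
      · exact ((measure_mono Set.sdiff_subset).trans_lt measure_closedBall_lt_top).ne
      · have hx1 : 1 < ‖x - b‖ := by
          have := hx.2
          rwa [mem_closedBall, dist_eq_norm, not_le] at this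
        have hx2 : ‖x - b‖ ≤ R := by
          have := hx.1
          rwa [mem_closedBall, dist_eq_norm] at this
        have h2 := hlow x hx1
        have h3 := Real.log_le_log (by linarith) hx2
        rw [Real.rpow_def_of_pos hR0, ← Real.exp_add, Real.exp_le_exp]
        nlinarith
    rw [setIntegral_const, hv, smul_eq_mul] at h1
    have e1 : R ^ ((n : ℝ) - γ) = R ^ (n : ℝ) * R ^ (-γ) := by
      rw [← Real.rpow_add hR0, sub_eq_add_neg]
    have h4 : R ^ (-γ) ≤ 1 := Real.rpow_le_one_of_one_le_of_nonpos hR (by linarith)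
    have hcω : 0 < c * ω := by positivity
    rw [← sub_le_iff_le_add, le_div_iff₀ hcω, e1]
    nlinarith
  obtain ⟨R, hR1, hR⟩ := (((tendsto_rpow_atTop (show 0 < (n : ℝ) - γ by linarith)).eventually
    (eventually_gt_atTop (I / (c * ω) + 1))).and (eventually_ge_atTop 1)).exists
  linarith [hbound R hR]

end MovingSpheres

theorem betaN_pos {n : ℕ} (hn : 1 ≤ n) : 0 < betaN n := by
  have hn' : (0 : ℝ) < n := by exact_mod_cast hn
  have hω : 0 < (volume (ball (0 : EuclideanSpace ℝ (Fin n)) 1)).toReal :=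
    ENNReal.toReal_pos (measure_ball_pos _ _ one_pos).ne' measure_ball_lt_top.ne
  have := Real.Gamma_pos_of_pos (show 0 < (n : ℝ) / 2 + 1 by positivity)
  have := Real.Gamma_pos_of_pos (show 0 < (n : ℝ) / 2 by positivity)
  unfold betaN
  positivity

theorem IE.exists_eq_logPot {n : ℕ} {μ : ℝ} {u : EuclideanSpace ℝ (Fin n) → ℝ}
    (h : FiniteEnergy n μ (betaN n) fun y => Real.exp ((2 * n - μ) / 2 * u y)) (hIE : IE n μ u) :
    ∃ C, ∀ x, u x = logPot (energyMeasure μ (betaN n) fun y =>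
      Real.exp ((2 * n - μ) / 2 * u y)) x + C := by
  obtain ⟨C, hC⟩ := hIE
  refine ⟨C, fun x => ?_⟩
  rw [hC x, logPot, h.integral_eq, ← integral_const_mul]
  congr 1
  refine integral_congr_ae (ae_of_all _ fun y => ?_)
  simp only [energyDensity, V, rieszPot]
  ring

/-- The moving-spheres inequality in polar form: `w_{l,b} ≥ 0` and `z_{l,b} ≥ 0` compare the values
of `u` and `log v` at two points `b + rθ`, `b + Rθ` with `rR = l⁻²`. -/
theorem exists_radial_le_of_IE {n : ℕ} (hn : 2 ≤ n) {μ : ℝ} (hμ0 : 0 < μ) (hμn : μ < n)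
    {u : EuclideanSpace ℝ (Fin n) → ℝ} (hu : ContDiff ℝ n u)
    (hB : CondB n μ u) (hIE : IE n μ u) (b : EuclideanSpace ℝ (Fin n)) :
    ∃ σ > 0, ∀ θ : EuclideanSpace ℝ (Fin n), ‖θ‖ = 1 → ∀ r R : ℝ, 0 < r → r < R → r * R ≤ σ →
      Real.log r + u (b + r • θ) ≤ Real.log R + u (b + R • θ) ∧
      μ / 2 * Real.log r + Real.log (V n μ u (b + r • θ)) ≤
        μ / 2 * Real.log R + Real.log (V n μ u (b + R • θ)) := by
  have hu1 : ContDiff ℝ 1 u := hu.of_le (by exact_mod_cast (by omega : 1 ≤ n))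
  set F := fun y => Real.exp ((2 * n - μ) / 2 * u y)
  have hF1 : ContDiff ℝ 1 F := Real.contDiff_exp.comp (contDiff_const.mul hu1)
  have h : FiniteEnergy n μ (betaN n) F :=
    ⟨hn, hμ0, hμn, betaN_pos (by omega), hF1.continuous, fun y => Real.exp_pos _, hB.1, hB.2⟩
  have hFn : ∀ y, 0 ≤ F y := fun y => (h.pos y).le
  obtain ⟨C, hC⟩ := hIE.exists_eq_logPot h
  have := h.isFiniteMeasure
  have hmass := h.mass_le_two (by ring) hu1.continuous hC
  have hlow : ∀ x, -(2 * 1 * Real.log (1 + ‖x‖)) - (-C) ≤ u x := fun x => by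
    have h1 := logPot_lower_bound h.integrable_inv x
    have h2 : 0 ≤ Real.log (1 + ‖x‖) := Real.log_nonneg (by linarith [norm_nonneg x])
    have h3 := mul_le_mul_of_nonneg_right hmass h2
    have h4 := hC x
    linarith
  obtain ⟨L, hL0, hL⟩ := exists_lipschitz_on_ball hu1 b 1
  obtain ⟨σ₁, hσ₁, H₁⟩ := exists_radial_le one_pos hL0 hL hlow
  obtain ⟨L', hL'0, hL'⟩ := exists_lipschitz_on_ball hF1 b 2
  obtain ⟨L'', hL''0, hL''⟩ := rieszPot_lipschitz h.one_le hμ0 hμn h.continuous hFn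
    h.integrable hL'0 hL'
  obtain ⟨c, hc, hcV⟩ := rieszPot_lower_bound h.one_le hμ0 hμn h.continuous h.pos h.integrable
  have hm : 0 < c * (‖b‖ + 2) ^ (-μ) := by positivity
  have hmV : ∀ y ∈ ball b 1, c * (‖b‖ + 2) ^ (-μ) ≤ rieszPot μ F y := fun y hy => by
    refine le_trans ?_ (hcV y)
    rw [mem_ball, dist_eq_norm] at hy
    gcongr c * ?_
    exact Real.rpow_le_rpow_of_nonpos (by positivity) (by linarith [norm_sub_norm_le y b])
      (by linarith)
  have hlowV : ∀ x, -(2 * (μ / 2) * Real.log (1 + ‖x‖)) - (-Real.log c) ≤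
      Real.log (rieszPot μ F x) := fun x => by
    have h1 : 0 < ‖x‖ + 1 := by positivity
    have h2 := Real.log_le_log (by positivity) (hcV x)
    rw [Real.log_mul hc.ne' (Real.rpow_pos_of_pos h1 _).ne', Real.log_rpow h1, add_comm ‖x‖ 1] at h2
    linarith
  obtain ⟨σ₂, hσ₂, H₂⟩ := exists_radial_le (f := fun x => Real.log (rieszPot μ F x))
    (L := (c * (‖b‖ + 2) ^ (-μ))⁻¹ * L'') (half_pos hμ0) (by positivity) (fun y hy y' hy' => by
      refine (abs_log_sub_log_le hm (hmV y hy) (hmV y' hy')).trans ?_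
      rw [mul_assoc]
      exact mul_le_mul_of_nonneg_left (hL'' y hy y' hy') (by positivity)) hlowV
  refine ⟨min σ₁ σ₂, lt_min hσ₁ hσ₂, fun θ hθ r R hr hrR hσ => ⟨?_, ?_⟩⟩
  · simpa only [one_mul] using H₁ θ hθ r R hr hrR (hσ.trans (min_le_left _ _))
  · exact H₂ θ hθ r R hr hrR (hσ.trans (min_le_right _ _))

theorem lambda_positive (n : ℕ) (hn : 2 ≤ n) (μ : ℝ) (hμ0 : 0 < μ) (hμn : μ < n)
    (u : EuclideanSpace ℝ (Fin n) → ℝ) (hu : ContDiff ℝ n u)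
    (hB : CondB n μ u) (hIE : IE n μ u) :
    ∀ b : EuclideanSpace ℝ (Fin n), 0 < lambdaB n μ u b := by
  intro b
  obtain ⟨σ, hσ, H⟩ := exists_radial_le_of_IE hn hμ0 hμn hu hB hIE b
  have hV : ∀ x, 0 < V n μ u x := FiniteEnergy.rieszPot_pos
    ⟨hn, hμ0, hμn, betaN_pos (n := n) (by omega), by have := hu.continuous; fun_prop,
      fun y => Real.exp_pos _, hB.1, hB.2⟩
  set S := {l : ℝ | 0 < l ∧ ∀ ρ : ℝ, l ≤ ρ → ∀ x : EuclideanSpace ℝ (Fin n),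
    0 < ‖x‖ → ‖x‖ < ρ → 0 ≤ wMS n u b ρ x ∧ 0 ≤ zMS n μ u b ρ x}
  have hne : S.Nonempty := by
    refine ⟨(√σ)⁻¹, by positivity, fun ρ hρ x hx hxρ => ?_⟩
    have hρ0 : 0 < ρ := hx.trans hxρ
    have hθ : ‖(‖x‖⁻¹ • x)‖ = 1 := by
      rw [norm_smul, norm_inv, norm_norm, inv_mul_cancel₀ hx.ne']
    have hr : 0 < ‖x‖ * (ρ ^ 2)⁻¹ := by positivity
    have hR : 0 < ‖x‖⁻¹ := by positivity
    have hrR : ‖x‖ * (ρ ^ 2)⁻¹ * ‖x‖⁻¹ = (ρ ^ 2)⁻¹ := by field_simp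
    have hlt : ‖x‖ * (ρ ^ 2)⁻¹ < ‖x‖⁻¹ := by
      rw [← div_eq_mul_inv, inv_eq_one_div, div_lt_div_iff₀ (by positivity) hx]
      nlinarith
    have hle : ‖x‖ * (ρ ^ 2)⁻¹ * ‖x‖⁻¹ ≤ σ := by
      rw [hrR]
      refine inv_le_of_inv_le₀ hσ ?_
      have := pow_le_pow_left₀ (by positivity) hρ 2
      rwa [inv_pow, Real.sq_sqrt hσ.le] at this
    obtain ⟨h1, h2⟩ := H _ hθ _ _ hr hlt hle
    have ex : x = (‖x‖⁻¹)⁻¹ • ‖x‖⁻¹ • x := by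
      rw [smul_smul, inv_inv, mul_inv_cancel₀ hx.ne', one_smul]
    rw [ex]
    exact ⟨(wMS_nonneg_iff hθ hr hR hrR).2 h1, (zMS_nonneg_iff hV hθ hr hR hρ0 hrR).2 h2⟩
  change 0 < sInf S
  by_contra! hcon
  refine not_integrable_of_radial_le hu.continuous (γ := (2 * n - μ) / 2) (by linarith)
    (by linarith) b (fun θ hθ r R hr hrR => ?_) hB.1
  have hR : 0 < R := hr.trans hrR
  have hρ : 0 < (√(r * R))⁻¹ := by positivity
  obtain ⟨l, hl, hlρ⟩ := exists_lt_of_csInf_lt hne (hcon.trans_lt hρ)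
  have hn1 : ‖R⁻¹ • θ‖ = R⁻¹ := by
    rw [norm_smul, hθ, mul_one, Real.norm_of_nonneg (by positivity)]
  have h1 := (hl.2 _ hlρ.le (R⁻¹ • θ) (by rw [hn1]; positivity) (by
    rw [hn1]
    refine inv_strictAnti₀ (by positivity) ?_
    rw [Real.sqrt_lt' hR, sq]
    exact mul_lt_mul_of_pos_right hrR hR)).1
  exact (wMS_nonneg_iff hθ hr hR (by
    rw [inv_pow, inv_inv, Real.sq_sqrt (by positivity)])).1 h1
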